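/- arXiv:1205.3632 — 4 statements merged into one kernel-verified Lean document; each statement's English description precedes it below -/
import Mathlib

section
/- There exists a Borel set K_0 ⊆ [0,1] such that μ_f(K_0) = 1 and dim_H(K_0) ≤ max{s(p_0(y)) : y ∈ [α, β]} / log 2. -/
open MeasureTheory Filter Set Matrix

noncomputable def Phi (a b c d z : ℝ) : ℝ := (a * z + b) / (c * z + d)

noncomputable def PhiM (M : Matrix (Fin 2) (Fin 2) ℝ) (z : ℝ) : ℝ :=
  (M 0 0 * z + M 0 1) / (M 1 0 * z + M 1 1)

noncomputable def entS (p : ℝ) : ℝ := -(p * Real.log p) - (1 - p) * Real.log (1 - p)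

noncomputable def Xdig (x : ℝ) (n : ℕ) : ℕ :=
  ⌊(2 : ℝ) ^ n * x⌋₊ - 2 * ⌊(2 : ℝ) ^ (n - 1) * x⌋₊

noncomputable def dyadI (x : ℝ) (n : ℕ) : Set ℝ :=
  Set.Ico ((⌊(2 : ℝ) ^ n * x⌋₊ : ℝ) / 2 ^ n) (((⌊(2 : ℝ) ^ n * x⌋₊ : ℝ) + 1) / 2 ^ n)

noncomputable def matProd (A : ℕ → Matrix (Fin 2) (Fin 2) ℝ) (x : ℝ) (n : ℕ) :
    Matrix (Fin 2) (Fin 2) ℝ :=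
  ((List.range n).map (fun j => A (Xdig x (j + 1)))).prod

noncomputable def Fcal (n : ℕ) : MeasurableSpace ℝ :=
  ⨆ i ∈ Finset.Icc 1 n, MeasurableSpace.comap (fun x : ℝ => Xdig x i) ⊤

noncomputable def Rfun (μf : Measure ℝ) (x : ℝ) (n : ℕ) : ℝ :=
  if n = 0 then 1 else (μf (dyadI x n)).toReal

theorem rpow_one_sub_le {p t M : ℝ} (hp : 0 < p) (hp1 : p ≤ 1) (ht : 0 ≤ t)
    (hM : -Real.log p ≤ M) (htM : t * M ≤ 1) :
    p ^ (1 - t) ≤ p * (1 + t * -Real.log p + t ^ 2 * M ^ 2) := by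
  have hL : 0 ≤ -Real.log p := neg_nonneg.2 (Real.log_nonpos hp.le hp1)
  have htL : 0 ≤ t * -Real.log p := mul_nonneg ht hL
  have htLM : t * -Real.log p ≤ t * M := mul_le_mul_of_nonneg_left hM ht
  have hexp := Real.abs_exp_sub_one_sub_id_le (x := t * -Real.log p)
    (by rw [abs_of_nonneg htL]; linarith)
  have hsq : (t * -Real.log p) ^ 2 ≤ (t * M) ^ 2 := pow_le_pow_left₀ htL htLM 2
  have heq : p ^ (1 - t) = p * Real.exp (t * -Real.log p) := by
    rw [Real.rpow_def_of_pos hp, mul_sub, mul_one, sub_eq_add_neg, Real.exp_add, Real.exp_log hp]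
    ring_nf
  rw [heq]
  refine mul_le_mul_of_nonneg_left ?_ hp.le
  have := (abs_le.1 hexp).2
  nlinarith

theorem rpow_add_rpow_le_exp_entS {p t M : ℝ} (hp : 0 < p) (hp1 : p < 1) (ht : 0 ≤ t)
    (hM : -Real.log p ≤ M) (hM' : -Real.log (1 - p) ≤ M) (htM : t * M ≤ 1) :
    p ^ (1 - t) + (1 - p) ^ (1 - t) ≤ Real.exp (t * (entS p + t * M ^ 2)) := by
  have h1 := rpow_one_sub_le hp hp1.le ht hM htM
  have h2 := rpow_one_sub_le (sub_pos.2 hp1) (by linarith) ht hM' htM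
  have h3 := Real.add_one_le_exp (t * (entS p + t * M ^ 2))
  unfold entS at h3 ⊢
  nlinarith

theorem entS_nonneg {p : ℝ} (hp : 0 < p) (hp1 : p < 1) : 0 ≤ entS p := by
  have h1 := mul_nonpos_of_nonneg_of_nonpos hp.le (Real.log_nonpos hp.le hp1.le)
  have h2 := mul_nonpos_of_nonneg_of_nonpos (sub_pos.2 hp1).le
    (Real.log_nonpos (sub_pos.2 hp1).le (by linarith))
  unfold entS
  linarith

theorem sum_range_two_mul (g : ℕ → ℝ) (N : ℕ) :
    ∑ k ∈ Finset.range (2 * N), g k = ∑ k ∈ Finset.range N, (g (2 * k) + g (2 * k + 1)) := by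
  induction N with
  | zero => simp
  | succ N ih => rw [Finset.sum_range_succ, ← ih, mul_add, mul_one, Finset.sum_range_succ,
      Finset.sum_range_succ, add_assoc]

/-- The half-open dyadic interval of level `n` with left endpoint `k / 2 ^ n`. -/
def dyadicIoc (n k : ℕ) : Set ℝ := Ioc ((k : ℝ) / 2 ^ n) (((k : ℝ) + 1) / 2 ^ n)

theorem exists_mem_dyadicIoc {x : ℝ} (hx : x ∈ Ioc (0 : ℝ) 1) (n : ℕ) :
    ∃ k < 2 ^ n, x ∈ dyadicIoc n k := by
  have h2 : (0 : ℝ) < 2 ^ n := by positivity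
  have hpos : 0 < ⌈x * 2 ^ n⌉₊ := Nat.ceil_pos.2 (mul_pos hx.1 h2)
  obtain ⟨k, hk⟩ := Nat.exists_eq_succ_of_ne_zero hpos.ne'
  have hle : ⌈x * 2 ^ n⌉₊ ≤ 2 ^ n := Nat.ceil_le.2 (by push_cast; nlinarith [hx.2])
  refine ⟨k, by omega, ?_, ?_⟩
  · rw [div_lt_iff₀ h2]
    exact Nat.lt_ceil.1 (by omega)
  · rw [le_div_iff₀ h2]
    have := Nat.le_ceil (x * 2 ^ n)
    rw [hk] at this
    exact_mod_cast this

theorem ediam_dyadicIoc_le (n k : ℕ) :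
    Metric.ediam (dyadicIoc n k) ≤ ENNReal.ofReal ((1 / 2) ^ n) := by
  rw [dyadicIoc, Real.ediam_Ioc]
  apply le_of_eq
  congr 1
  rw [one_div, inv_pow]
  ring

/-- Nonnegative dyadic weights split at every node in proportions `p : 1 - p`, with `p` in `P`. -/
def SplitsIn (P : Set ℝ) (w : ℕ → ℕ → ℝ) : Prop :=
  ∀ n, ∀ k < 2 ^ n, 0 ≤ w n k ∧
    ∃ p ∈ P, w (n + 1) (2 * k) = p * w n k ∧ w (n + 1) (2 * k + 1) = (1 - p) * w n k

theorem SplitsIn.sum_eq_one {P : Set ℝ} {w : ℕ → ℕ → ℝ} (hw : SplitsIn P w) (h0 : w 0 0 = 1)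
    (n : ℕ) : ∑ k ∈ Finset.range (2 ^ n), w n k = 1 := by
  induction n with
  | zero => simp [h0]
  | succ n ih =>
    rw [pow_succ', sum_range_two_mul, ← ih]
    refine Finset.sum_congr rfl fun k hk => ?_
    obtain ⟨-, p, -, h1, h2⟩ := hw n k (Finset.mem_range.1 hk)
    rw [h1, h2]
    ring

theorem SplitsIn.sum_rpow_le {P : Set ℝ} {w : ℕ → ℕ → ℝ} (hw : SplitsIn P w) (h0 : w 0 0 = 1)
    {t C : ℝ} (hP : ∀ p ∈ P, 0 < p ∧ p < 1)
    (hC : ∀ p ∈ P, p ^ (1 - t) + (1 - p) ^ (1 - t) ≤ Real.exp C) (n : ℕ) :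
    ∑ k ∈ Finset.range (2 ^ n), w n k ^ (1 - t) ≤ Real.exp (n * C) := by
  induction n with
  | zero => simp [h0]
  | succ n ih =>
    rw [pow_succ', sum_range_two_mul]
    calc _ ≤ ∑ k ∈ Finset.range (2 ^ n), Real.exp C * w n k ^ (1 - t) := by
          refine Finset.sum_le_sum fun k hk => ?_
          obtain ⟨hnn, p, hp, h1, h2⟩ := hw n k (Finset.mem_range.1 hk)
          rw [h1, h2, Real.mul_rpow (hP p hp).1.le hnn,
            Real.mul_rpow (sub_pos.2 (hP p hp).2).le hnn, ← add_mul]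
          exact mul_le_mul_of_nonneg_right (hC p hp) (Real.rpow_nonneg hnn _)
      _ ≤ Real.exp C * Real.exp (n * C) := by
          rw [← Finset.mul_sum]
          exact mul_le_mul_of_nonneg_left ih (Real.exp_pos _).le
      _ = _ := by rw [← Real.exp_add]; push_cast; ring_nf

/-- Union of the dyadic intervals of level `n` whose weight is less than `exp (-n R)`. -/
def lightSet (w : ℕ → ℕ → ℝ) (R : ℝ) (n : ℕ) : Set ℝ :=
  ⋃ k ∈ {k ∈ Finset.range (2 ^ n) | w n k < Real.exp (-(n * R))}, dyadicIoc n k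

theorem measurableSet_lightSet (w : ℕ → ℕ → ℝ) (R : ℝ) (n : ℕ) :
    MeasurableSet (lightSet w R n) :=
  Finset.measurableSet_biUnion _ fun _ _ => measurableSet_Ioc

theorem SplitsIn.measure_lightSet_le {P : Set ℝ} {w : ℕ → ℕ → ℝ} (hw : SplitsIn P w)
    (h0 : w 0 0 = 1) {μ : Measure ℝ}
    (hμ : ∀ n, ∀ k < 2 ^ n, μ (dyadicIoc n k) = ENNReal.ofReal (w n k))
    {t R ε : ℝ} (ht : 0 < t) (hP : ∀ p ∈ P, 0 < p ∧ p < 1)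
    (hC : ∀ p ∈ P, p ^ (1 - t) + (1 - p) ^ (1 - t) ≤ Real.exp (t * (R - ε))) (n : ℕ) :
    μ (lightSet w R n) ≤ ENNReal.ofReal (Real.exp (-(t * ε)) ^ n) := by
  set s := {k ∈ Finset.range (2 ^ n) | w n k < Real.exp (-(n * R))} with hs
  have hnn : ∀ k ∈ Finset.range (2 ^ n), 0 ≤ w n k := fun k hk => (hw n k (Finset.mem_range.1 hk)).1
  calc μ (lightSet w R n) ≤ ∑ k ∈ s, μ (dyadicIoc n k) := measure_biUnion_finset_le _ _
    _ = ∑ k ∈ s, ENNReal.ofReal (w n k) :=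
        Finset.sum_congr rfl fun k hk => hμ n k (Finset.mem_range.1 (Finset.mem_filter.1 hk).1)
    _ = ENNReal.ofReal (∑ k ∈ s, w n k) :=
        (ENNReal.ofReal_sum_of_nonneg fun k hk => hnn k (Finset.mem_filter.1 hk).1).symm
    _ ≤ _ := ENNReal.ofReal_le_ofReal ?_
  calc ∑ k ∈ s, w n k ≤ ∑ k ∈ s, Real.exp (-(n * R)) ^ t * w n k ^ (1 - t) := by
        refine Finset.sum_le_sum fun k hk => ?_
        obtain ⟨hk, hlt⟩ := Finset.mem_filter.1 hk
        rcases (hnn k hk).eq_or_lt with h | h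
        · rw [← h]
          positivity
        calc w n k = w n k ^ t * w n k ^ (1 - t) := by
              rw [← Real.rpow_add h, add_sub_cancel, Real.rpow_one]
          _ ≤ _ := mul_le_mul_of_nonneg_right (Real.rpow_le_rpow h.le hlt.le ht.le)
              (Real.rpow_nonneg h.le _)
    _ ≤ ∑ k ∈ Finset.range (2 ^ n), Real.exp (-(n * R)) ^ t * w n k ^ (1 - t) :=
        Finset.sum_le_sum_of_subset_of_nonneg (Finset.filter_subset _ _) fun k hk _ =>
          mul_nonneg (by positivity) (Real.rpow_nonneg (hnn k hk) _)
    _ ≤ Real.exp (-(n * R)) ^ t * Real.exp (n * (t * (R - ε))) := by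
        rw [← Finset.mul_sum]
        exact mul_le_mul_of_nonneg_left (hw.sum_rpow_le h0 hP hC n) (by positivity)
    _ = _ := by
        rw [← Real.exp_mul, ← Real.exp_add, ← Real.exp_nat_mul]
        ring_nf

theorem SplitsIn.dimH_le {P : Set ℝ} {w : ℕ → ℕ → ℝ} (hw : SplitsIn P w) (h0 : w 0 0 = 1)
    {R : ℝ} (hR : 0 ≤ R) :
    dimH (Ioc (0 : ℝ) 1 ∩ ⋃ m, ⋂ n ≥ m, (lightSet w R n)ᶜ) ≤
      ENNReal.ofReal (R / Real.log 2) := by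
  have hl2 : 0 < Real.log 2 := Real.log_pos one_lt_two
  have hd : 0 ≤ R / Real.log 2 := by positivity
  rw [inter_iUnion, dimH_iUnion]
  refine iSup_le fun m => ?_
  refine dimH_le_of_hausdorffMeasure_ne_top (d := (R / Real.log 2).toNNReal)
    (ne_top_of_le_ne_top ENNReal.one_ne_top ?_)
  rw [Real.coe_toNNReal _ hd]
  let s : ℕ → Finset ℕ := fun n => {k ∈ Finset.range (2 ^ n) | Real.exp (-(n * R)) ≤ w n k}
  refine (Measure.hausdorffMeasure_le_liminf_sum (l := atTop) (β := ℕ) (ι := fun n => s n)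
    (R / Real.log 2) _ (fun n => ENNReal.ofReal ((1 / 2) ^ n)) ?_ (fun n k => dyadicIoc n k)
    (.of_forall fun n k => ediam_dyadicIoc_le n k) ?_).trans ?_
  · rw [← ENNReal.ofReal_zero]
    exact ENNReal.tendsto_ofReal
      (tendsto_pow_atTop_nhds_zero_of_lt_one (by norm_num) (by norm_num))
  · filter_upwards [eventually_ge_atTop m] with n hn x ⟨hx, hxm⟩
    obtain ⟨k, hk, hxk⟩ := exists_mem_dyadicIoc hx n
    have hlight : x ∉ lightSet w R n := mem_iInter₂.1 hxm n hn
    refine mem_iUnion.2 ⟨⟨k, Finset.mem_filter.2 ⟨Finset.mem_range.2 hk, ?_⟩⟩, hxk⟩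
    by_contra! hlt
    exact hlight (mem_iUnion₂.2 ⟨k, Finset.mem_filter.2 ⟨Finset.mem_range.2 hk, hlt⟩, hxk⟩)
  refine liminf_le_of_frequently_le' (.of_forall fun n => ?_)
  have hcard : (s n).card * Real.exp (-(n * R)) ≤ 1 := by
    rw [← hw.sum_eq_one h0 n, ← nsmul_eq_mul]
    exact (Finset.card_nsmul_le_sum _ _ _ fun k hk => (Finset.mem_filter.1 hk).2).trans
      (Finset.sum_le_sum_of_subset_of_nonneg (Finset.filter_subset _ _) fun k hk _ =>
        (hw n k (Finset.mem_range.1 hk)).1)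
  have hpow : ((1 / 2 : ℝ) ^ n) ^ (R / Real.log 2) = Real.exp (-(n * R)) := by
    rw [Real.rpow_def_of_pos (by positivity), Real.log_pow, one_div, Real.log_inv]
    congr 1
    field_simp
  calc ∑ k : s n, Metric.ediam (dyadicIoc n k) ^ (R / Real.log 2)
      ≤ ∑ k : s n, ENNReal.ofReal (Real.exp (-(n * R))) := by
        refine Finset.sum_le_sum fun k _ => ?_
        rw [← hpow, ← ENNReal.ofReal_rpow_of_nonneg (by positivity) hd]
        exact ENNReal.rpow_le_rpow (ediam_dyadicIoc_le n k) hd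
    _ = ENNReal.ofReal ((s n).card * Real.exp (-(n * R))) := by
        rw [ENNReal.ofReal_mul (by positivity)]
        simp
    _ ≤ 1 := ENNReal.ofReal_le_one.2 hcard

theorem SplitsIn.exists_measurableSet_dimH_le {P : Set ℝ} {w : ℕ → ℕ → ℝ} (hw : SplitsIn P w)
    (h0 : w 0 0 = 1) {μ : Measure ℝ} [IsProbabilityMeasure μ]
    (hμ : ∀ n, ∀ k < 2 ^ n, μ (dyadicIoc n k) = ENNReal.ofReal (w n k))
    {M H : ℝ} (hP : ∀ p ∈ P, 0 < p ∧ p < 1)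
    (hM : ∀ p ∈ P, -Real.log p ≤ M ∧ -Real.log (1 - p) ≤ M)
    (hH : ∀ p ∈ P, entS p ≤ H) (hH0 : 0 ≤ H) :
    ∃ K : Set ℝ, MeasurableSet K ∧ K ⊆ Icc 0 1 ∧ μ K = 1 ∧
      dimH K ≤ ENNReal.ofReal (H / Real.log 2) := by
  let L : ℝ → Set ℝ := fun R => ⋃ m, ⋂ n ≥ m, (lightSet w R n)ᶜ
  have hLmeas : ∀ R, MeasurableSet (L R) := fun R => .iUnion fun m => .iInter fun n =>
    .iInter fun _ => (measurableSet_lightSet w R n).compl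
  have hLae : ∀ ε > 0, ∀ᵐ x ∂μ, x ∈ L (H + 2 * ε) := by
    intro ε hε
    obtain ⟨t, ht, htM, htM'⟩ : ∃ t > 0, t * M ≤ 1 ∧ t * M ^ 2 ≤ ε := by
      have hev : ∀ᶠ t in nhdsWithin (0 : ℝ) (Ioi 0), t * M < 1 ∧ t * M ^ 2 < ε := by
        refine Eventually.filter_mono nhdsWithin_le_nhds (Eventually.and ?_ ?_)
        · exact (by fun_prop : Continuous fun t : ℝ => t * M).continuousAt.eventually_lt
            continuousAt_const (by simp)
        · exact (by fun_prop : Continuous fun t : ℝ => t * M ^ 2).continuousAt.eventually_lt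
            continuousAt_const (by simpa using hε)
      obtain ⟨t, ⟨h1, h2⟩, h3⟩ := (hev.and self_mem_nhdsWithin).exists
      exact ⟨t, h3, h1.le, h2.le⟩
    have hbound := hw.measure_lightSet_le h0 hμ (R := H + 2 * ε) (ε := ε) ht hP (fun p hp =>
      (rpow_add_rpow_le_exp_entS (hP p hp).1 (hP p hp).2 ht.le (hM p hp).1 (hM p hp).2 htM).trans
        (Real.exp_le_exp.2 (mul_le_mul_of_nonneg_left (by linarith [hH p hp]) ht.le)))
    have hsum : ∑' n, μ (lightSet w (H + 2 * ε) n) ≠ ⊤ := by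
      refine ne_top_of_le_ne_top ?_ (ENNReal.tsum_le_tsum hbound)
      refine (summable_geometric_of_lt_one (Real.exp_pos _).le ?_).tsum_ofReal_ne_top
      rw [Real.exp_lt_one_iff]
      have := mul_pos ht hε
      linarith
    filter_upwards [ae_eventually_notMem hsum] with x hx
    obtain ⟨m, hm⟩ := eventually_atTop.1 hx
    exact mem_iUnion.2 ⟨m, mem_iInter₂.2 hm⟩
  have hIoc : ∀ᵐ x ∂μ, x ∈ Ioc (0 : ℝ) 1 := by
    have h := hμ 0 0 (by simp)
    rw [h0, ENNReal.ofReal_one] at h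
    have := (prob_compl_eq_zero_iff (measurableSet_Ioc (a := (0:ℝ)) (b := 1))).2
      (by simpa [dyadicIoc] using h)
    exact this
  refine ⟨Ioc 0 1 ∩ ⋂ j : ℕ, L (H + 2 * (1 / ((j : ℝ) + 1))),
    measurableSet_Ioc.inter (.iInter fun j => hLmeas _),
    inter_subset_left.trans Ioc_subset_Icc_self, ?_, ?_⟩
  · refine (mem_ae_iff_prob_eq_one (measurableSet_Ioc.inter (.iInter fun j => hLmeas _))).1 ?_
    filter_upwards [hIoc, ae_all_iff.2 fun j : ℕ => hLae (1 / ((j : ℝ) + 1)) (by positivity)]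
      with x hx hx'
    exact ⟨hx, mem_iInter.2 hx'⟩
  · have hlim : Tendsto (fun j : ℕ => ENNReal.ofReal ((H + 2 * (1 / ((j : ℝ) + 1))) / Real.log 2))
        atTop (nhds (ENNReal.ofReal (H / Real.log 2))) := by
      refine ENNReal.tendsto_ofReal (Tendsto.div_const ?_ _)
      simpa using (tendsto_one_div_add_atTop_nhds_zero_nat.const_mul (2 : ℝ)).const_add H
    refine ge_of_tendsto' hlim fun j => ?_
    exact (dimH_mono (inter_subset_inter_right _ (iInter_subset _ j))).trans
      (hw.dimH_le h0 (by positivity))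

theorem mul_add_pos_of_mem_Icc {c d z : ℝ} (hd : 0 < d) (hcd : 0 < c + d) (hz : z ∈ Icc (0 : ℝ) 1) :
    0 < c * z + d := by
  rcases hz.2.eq_or_lt with h | h
  · simpa [h] using hcd
  · nlinarith [mul_nonneg hz.1 hcd.le, mul_pos (sub_pos.2 h) hd]

theorem div_linear_comp_Phi {a b c d p q r s z : ℝ} (h : c * z + d ≠ 0) :
    (p * Phi a b c d z + q) / (r * Phi a b c d z + s) =
      ((p * a + q * c) * z + (p * b + q * d)) / ((r * a + s * c) * z + (r * b + s * d)) := by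
  unfold Phi
  rw [← mul_div_mul_right _ _ h]
  congr 1 <;> rw [add_mul, mul_assoc, div_mul_cancel₀ _ h] <;> ring

/-- The pairs `(r, s)` with `0 < s` whose slope `r / s` lies in `[α, β]`. -/
def slopeCone (α β : ℝ) : Set (ℝ × ℝ) := {v | 0 < v.2 ∧ α * v.2 ≤ v.1 ∧ v.1 ≤ β * v.2}

theorem slopeCone_mem_of_lower_triangular {a c d α β r s : ℝ} (ha : 0 < a) (had : a < d)
    (hα : α ≤ c / (d - a)) (hβ : c / (d - a) ≤ β) (h : (r, s) ∈ slopeCone α β) :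
    (r * a + s * c, s * d) ∈ slopeCone α β := by
  obtain ⟨hs, h1, h2⟩ : 0 < s ∧ α * s ≤ r ∧ r ≤ β * s := h
  rw [le_div_iff₀ (sub_pos.2 had)] at hα
  rw [div_le_iff₀ (sub_pos.2 had)] at hβ
  refine ⟨mul_pos hs (ha.trans had), ?_, ?_⟩
  · change α * (s * d) ≤ r * a + s * c
    nlinarith [mul_le_mul_of_nonneg_right h1 ha.le, mul_le_mul_of_nonneg_left hα hs.le]
  · change r * a + s * c ≤ β * (s * d)
    nlinarith [mul_le_mul_of_nonneg_right h2 ha.le, mul_le_mul_of_nonneg_left hβ hs.le]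

theorem slopeCone_mem_of_fixed_one {a b c d α β r s : ℝ} (hb : 0 < b) (hbd : b < d)
    (hsum : a + b = c + d) (hdet : 0 < a * d - b * c) (hα1 : -1 < α) (hαβ : α ≤ β)
    (hα : α ≤ c / b) (hβ : c / b ≤ β) (h : (r, s) ∈ slopeCone α β) :
    (r * a + s * c, r * b + s * d) ∈ slopeCone α β := by
  obtain ⟨hs, h1, h2⟩ : 0 < s ∧ α * s ≤ r ∧ r ≤ β * s := h
  rw [le_div_iff₀ hb] at hα
  rw [div_le_iff₀ hb] at hβ
  obtain rfl : a = c + d - b := by linarith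
  have hden : ∀ y, -1 < y → 0 < b * y + d := fun y hy => by nlinarith
  have hs' : 0 < r * b + s * d := by
    nlinarith [mul_pos hs (hden α hα1), mul_le_mul_of_nonneg_right h1 hb.le]
  refine ⟨hs', ?_, ?_⟩
  · refine le_of_mul_le_mul_right ?_ (hden α hα1)
    have e1 := mul_nonneg hdet.le (sub_nonneg.2 h1)
    have e2 := mul_nonneg hs'.le (mul_nonneg (by linarith : 0 ≤ α + 1) (sub_nonneg.2 hα))
    dsimp only
    linarith
  · refine le_of_mul_le_mul_right ?_ (hden β (hα1.trans_le hαβ))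
    have e1 := mul_nonneg hdet.le (sub_nonneg.2 h2)
    have e2 := mul_nonneg hs'.le (mul_nonneg (by linarith : 0 ≤ β + 1) (sub_nonneg.2 hβ))
    dsimp only
    linarith

/-- On every dyadic interval `f` is a linear fractional image of itself, the bottom row of whose
matrix stays in any cone preserved by right multiplication by the two matrices of the equation. -/
theorem exists_linearFractional_of_deRham {a0 b0 c0 d0 a1 b1 c1 d1 : ℝ}
    {V : Set (ℝ × ℝ)} {f : ℝ → ℝ}
    (hf : ∀ u ∈ Icc (0 : ℝ) 1, f u ∈ Icc (0 : ℝ) 1)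
    (hdR0 : ∀ x ∈ Icc (0 : ℝ) (1 / 2), f x = Phi a0 b0 c0 d0 (f (2 * x)))
    (hdR1 : ∀ x ∈ Icc (1 / 2 : ℝ) 1, f x = Phi a1 b1 c1 d1 (f (2 * x - 1)))
    (hd0 : 0 < d0) (hcd0 : 0 < c0 + d0) (hd1 : 0 < d1) (hcd1 : 0 < c1 + d1)
    (hV : ((0 : ℝ), (1 : ℝ)) ∈ V)
    (hV0 : ∀ r s, (r, s) ∈ V → (r * a0 + s * c0, r * b0 + s * d0) ∈ V)
    (hV1 : ∀ r s, (r, s) ∈ V → (r * a1 + s * c1, r * b1 + s * d1) ∈ V) (n : ℕ) :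
    ∀ k : ℕ, k < 2 ^ n → ∃ p q r s, (r, s) ∈ V ∧
      ∀ u ∈ Icc (0 : ℝ) 1, f ((k + u) / 2 ^ n) = (p * f u + q) / (r * f u + s) := by
  induction n with
  | zero =>
    intro k hk
    obtain rfl : k = 0 := by simpa using hk
    exact ⟨1, 0, 0, 1, hV, fun u _ => by simp⟩
  | succ n ih =>
    intro k hk
    obtain ⟨j, rfl | rfl⟩ := k.even_or_odd'
    all_goals
      obtain ⟨p, q, r, s, hrs, h⟩ := ih j (by rw [pow_succ] at hk; omega)
    · refine ⟨p * a0 + q * c0, p * b0 + q * d0, _, _, hV0 r s hrs, fun u hu => ?_⟩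
      have hu2 : u / 2 ∈ Icc (0 : ℝ) (1 / 2) := ⟨by linarith [hu.1], by linarith [hu.2]⟩
      have harg : (((2 * j : ℕ) : ℝ) + u) / 2 ^ (n + 1) = (j + u / 2) / 2 ^ n := by
        push_cast; field_simp; ring
      rw [harg, h _ ⟨hu2.1, by linarith [hu2.2]⟩, hdR0 _ hu2, mul_div_cancel₀ u two_ne_zero,
        div_linear_comp_Phi (mul_add_pos_of_mem_Icc hd0 hcd0 (hf u hu)).ne']
    · refine ⟨p * a1 + q * c1, p * b1 + q * d1, _, _, hV1 r s hrs, fun u hu => ?_⟩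
      have hu2 : (1 + u) / 2 ∈ Icc (1 / 2 : ℝ) 1 := ⟨by linarith [hu.1], by linarith [hu.2]⟩
      have harg : (((2 * j + 1 : ℕ) : ℝ) + u) / 2 ^ (n + 1) = (j + (1 + u) / 2) / 2 ^ n := by
        push_cast; field_simp; ring
      rw [harg, h _ ⟨by linarith [hu2.1], hu2.2⟩, hdR1 _ hu2, mul_div_cancel₀ _ two_ne_zero,
        add_sub_cancel_left, div_linear_comp_Phi (mul_add_pos_of_mem_Icc hd1 hcd1 (hf u hu)).ne']

theorem splitsIn_of_linearFractional {α β γ : ℝ} {f : ℝ → ℝ} (hα : -1 < α) (hγ : 1 < γ)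
    (hfm : MonotoneOn f (Icc 0 1)) (hf0 : f 0 = 0) (hf1 : f 1 = 1) (hfhalf : f (1 / 2) = 1 / γ)
    (hlf : ∀ n : ℕ, ∀ k : ℕ, k < 2 ^ n → ∃ p q r s, (r, s) ∈ slopeCone α β ∧
      ∀ u ∈ Icc (0 : ℝ) 1, f ((k + u) / 2 ^ n) = (p * f u + q) / (r * f u + s)) :
    SplitsIn ((fun y => (y + 1) / (y + γ)) '' Icc α β)
      fun n k => f ((k + 1) / 2 ^ n) - f (k / 2 ^ n) := by
  intro n k hk
  have h2 : (0 : ℝ) < 2 ^ n := by positivity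
  have hk' : (k : ℝ) + 1 ≤ 2 ^ n := by exact_mod_cast hk
  refine ⟨sub_nonneg.2 (hfm ⟨by positivity, (div_le_one h2).2 (by linarith)⟩
    ⟨by positivity, (div_le_one h2).2 hk'⟩ (by gcongr; linarith)), ?_⟩
  obtain ⟨p, q, r, s, ⟨hs, h1, h2⟩, h⟩ := hlf n k hk
  dsimp only at hs h1 h2
  have hrs : 0 < r + s := by nlinarith
  have hrγ : 0 < r + s * γ := by nlinarith
  have e0 := h 0 (by simp)
  have e1 := h 1 (by simp)
  have eh := h (1 / 2) (by norm_num)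
  rw [hf0, add_zero] at e0
  rw [hf1] at e1
  rw [hfhalf] at eh
  have g0 : ((2 * k : ℕ) : ℝ) / 2 ^ (n + 1) = k / 2 ^ n := by push_cast; field_simp; ring
  have g1 : (((2 * k : ℕ) : ℝ) + 1) / 2 ^ (n + 1) = (k + 1 / 2) / 2 ^ n := by
    push_cast; field_simp; ring
  have g1' : ((2 * k + 1 : ℕ) : ℝ) / 2 ^ (n + 1) = (k + 1 / 2) / 2 ^ n := by
    push_cast; field_simp; ring
  have g2 : (((2 * k + 1 : ℕ) : ℝ) + 1) / 2 ^ (n + 1) = (k + 1) / 2 ^ n := by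
    push_cast; field_simp; ring
  have hsplit : f ((k + 1 / 2) / 2 ^ n) - f (k / 2 ^ n) =
      (r / s + 1) / (r / s + γ) * (f ((k + 1) / 2 ^ n) - f (k / 2 ^ n)) := by
    have hy : (r / s + 1) / (r / s + γ) = (r + s) / (r + s * γ) := by
      rw [← mul_div_mul_right _ _ hs.ne']
      congr 1 <;> field_simp
    have hm : (p * (1 / γ) + q) / (r * (1 / γ) + s) = (p + q * γ) / (r + s * γ) := by
      have hγ0 : γ ≠ 0 := by linarith
      rw [← mul_div_mul_right _ _ hγ0]
      congr 1 <;> field_simp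
    rw [e0, e1, eh, hy, hm]
    simp only [mul_zero, zero_add, mul_one]
    rw [div_sub_div _ _ hrγ.ne' hs.ne', div_sub_div _ _ hrs.ne' hs.ne', div_mul_div_comm,
      div_eq_div_iff (by positivity) (by positivity)]
    ring
  refine ⟨_, ⟨r / s, ⟨(le_div_iff₀ hs).2 h1, (div_le_iff₀ hs).2 h2⟩, rfl⟩, ?_, ?_⟩
  · simp only [g0, g1]
    exact hsplit
  · simp only [g1', g2]
    linear_combination -hsplit

theorem measure_Ioc_of_measure_Iic {μ : Measure ℝ} [IsFiniteMeasure μ] {f : ℝ → ℝ} {S : Set ℝ}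
    (hμ : ∀ x ∈ S, μ (Iic x) = ENNReal.ofReal (f x)) {a b : ℝ} (ha : a ∈ S) (hb : b ∈ S)
    (hab : a ≤ b) (hfa : 0 ≤ f a) : μ (Ioc a b) = ENNReal.ofReal (f b - f a) := by
  rw [← Iic_sdiff_Iic, measure_sdiff (Iic_subset_Iic.2 hab) measurableSet_Iic.nullMeasurableSet
    (measure_ne_top _ _), hμ a ha, hμ b hb, ENNReal.ofReal_sub _ hfa]

theorem stmt0
    (a0 b0 c0 d0 a1 b1 c1 d1 : ℝ)
    (hb0 : b0 = 0)
    (hA1a : 0 < (a0 + b0) / (c0 + d0))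
    (hA1b : (a0 + b0) / (c0 + d0) = b1 / d1)
    (hA1c : b1 / d1 < (a1 + b1) / (c1 + d1))
    (hA1d : (a1 + b1) / (c1 + d1) = 1)
    (hA20 : 0 < a0 * d0 - b0 * c0)
    (hA21 : 0 < a1 * d1 - b1 * c1)
    (hA30 : Real.sqrt (a0 * d0 - b0 * c0) < min d0 (c0 + d0))
    (hA31 : Real.sqrt (a1 * d1 - b1 * c1) < min d1 (c1 + d1))
    (f : ℝ → ℝ)
    (hfc : ContinuousOn f (Set.Icc 0 1))
    (hfm : StrictMonoOn f (Set.Icc 0 1))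
    (hf0 : f 0 = 0) (hf1 : f 1 = 1)
    (hdR0 : ∀ x ∈ Set.Icc (0 : ℝ) (1 / 2), f x = Phi a0 b0 c0 d0 (f (2 * x)))
    (hdR1 : ∀ x ∈ Set.Icc (1 / 2 : ℝ) 1, f x = Phi a1 b1 c1 d1 (f (2 * x - 1)))
    (μf : Measure ℝ) [IsProbabilityMeasure μf]
    (hμf : ∀ x ∈ Set.Icc (0 : ℝ) 1, μf (Set.Iic x) = ENNReal.ofReal (f x))
    (γ : ℝ) (hγ : γ = 1 / Phi a0 b0 c0 d0 1)
    (α : ℝ) (hα : α = min (min 0 (c0 / (d0 - a0))) (c1 / b1))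
    (β : ℝ) (hβ : β = max (max 0 (c0 / (d0 - a0))) (c1 / b1))
    :
    ∃ K0 : Set ℝ, MeasurableSet K0 ∧ K0 ⊆ Set.Icc 0 1 ∧ μf K0 = 1 ∧
      dimH K0 ≤ ENNReal.ofReal
        (sSup ((fun y => entS ((y + 1) / (y + γ))) '' Set.Icc α β) / Real.log 2) := by
  subst hb0
  rw [add_zero] at hA1a hA1b
  rw [zero_mul, sub_zero] at hA20 hA30
  obtain ⟨hd0', hcd0'⟩ := lt_min_iff.1 hA30
  obtain ⟨hd1', hcd1'⟩ := lt_min_iff.1 hA31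
  have hd0 : 0 < d0 := (Real.sqrt_nonneg _).trans_lt hd0'
  have hcd0 : 0 < c0 + d0 := (Real.sqrt_nonneg _).trans_lt hcd0'
  have hd1 : 0 < d1 := (Real.sqrt_nonneg _).trans_lt hd1'
  have hcd1 : 0 < c1 + d1 := (Real.sqrt_nonneg _).trans_lt hcd1'
  rw [Real.sqrt_lt' hd0] at hd0'
  rw [Real.sqrt_lt' hcd1] at hcd1'
  have ha0 : 0 < a0 := (pos_iff_pos_of_mul_pos hA20).2 hd0
  have had0 : a0 < d0 := by nlinarith
  have hb1 : 0 < b1 := (div_pos_iff_of_pos_right hd1).1 (hA1b ▸ hA1a)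
  rw [hA1d] at hA1c
  have hbd1 : b1 < d1 := (div_lt_one hd1).1 hA1c
  have hsum1 : a1 + b1 = c1 + d1 := (div_eq_one_iff_eq hcd1.ne').1 hA1d
  have hac0 : a0 < c0 + d0 := (div_lt_one hcd0).1 (hA1b ▸ hA1c)
  have hcb1 : 0 < c1 + b1 := by
    obtain rfl : a1 = c1 + d1 - b1 := by linarith
    nlinarith
  have hα1 : -1 < α := by
    rw [hα]
    refine lt_min (lt_min (by norm_num) ?_) ?_
    · rw [lt_div_iff₀ (sub_pos.2 had0)]
      linarith
    · rw [lt_div_iff₀ hb1]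
      linarith
  have hα0 : α ≤ 0 := hα ▸ (min_le_left _ _).trans (min_le_left _ _)
  have hβ0 : 0 ≤ β := hβ ▸ (le_max_left _ _).trans (le_max_left _ _)
  have hγ' : γ = (c0 + d0) / a0 := by simp [hγ, Phi]
  have hγ1 : 1 < γ := by rw [hγ']; exact (one_lt_div ha0).2 hac0
  have hmem : ∀ u ∈ Icc (0 : ℝ) 1, f u ∈ Icc (0 : ℝ) 1 := fun u hu =>
    ⟨hf0 ▸ hfm.monotoneOn (by simp) hu hu.1, hf1 ▸ hfm.monotoneOn hu (by simp) hu.2⟩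
  have hfhalf : f (1 / 2) = 1 / γ := by
    rw [hdR0 (1 / 2) (by norm_num), mul_one_div_cancel two_ne_zero, hf1, hγ, one_div_one_div]
  have hsplits := splitsIn_of_linearFractional hα1 hγ1 hfm.monotoneOn hf0 hf1 hfhalf
    (exists_linearFractional_of_deRham (V := slopeCone α β) hmem hdR0 hdR1 hd0 hcd0 hd1 hcd1
      ⟨one_pos, by simpa using hα0, by simpa using hβ0⟩
      (fun r s h => by
        simpa using slopeCone_mem_of_lower_triangular ha0 had0
          (hα ▸ (min_le_left _ _).trans (min_le_right _ _))
          (hβ ▸ (le_max_right _ _).trans (le_max_left _ _)) h)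
      (fun r s h => slopeCone_mem_of_fixed_one hb1 hbd1 hsum1 hA21 hα1 (hα0.trans hβ0)
        (hα ▸ min_le_right _ _) (hβ ▸ le_max_right _ _) h))
  have hμI : ∀ n, ∀ k < 2 ^ n, μf (dyadicIoc n k) =
      ENNReal.ofReal (f (((k : ℝ) + 1) / 2 ^ n) - f ((k : ℝ) / 2 ^ n)) := by
    intro n k hk
    have h2 : (0 : ℝ) < 2 ^ n := by positivity
    have hk' : (k : ℝ) + 1 ≤ 2 ^ n := by exact_mod_cast hk
    have hl : (k : ℝ) / 2 ^ n ∈ Icc (0 : ℝ) 1 := ⟨by positivity, (div_le_one h2).2 (by linarith)⟩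
    exact measure_Ioc_of_measure_Iic hμf hl ⟨by positivity, (div_le_one h2).2 hk'⟩
      (by gcongr; linarith) (hmem _ hl).1
  have hp01 : ∀ y ∈ Icc α β, 0 < (y + 1) / (y + γ) ∧ (y + 1) / (y + γ) < 1 := by
    intro y hy
    have h1 : 0 < y + 1 := by linarith [hy.1]
    exact ⟨div_pos h1 (by linarith), (div_lt_one (by linarith)).2 (by linarith)⟩
  have hpc : ContinuousOn (fun y => (y + 1) / (y + γ)) (Icc α β) :=
    (by fun_prop : Continuous fun y : ℝ => y + 1).continuousOn.div
      (by fun_prop : Continuous fun y : ℝ => y + γ).continuousOn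
      fun y hy => by linarith [hy.1]
  have hlog : ContinuousOn (fun y => Real.log ((y + 1) / (y + γ))) (Icc α β) :=
    hpc.log fun y hy => (hp01 y hy).1.ne'
  have hlog' : ContinuousOn (fun y => Real.log (1 - (y + 1) / (y + γ))) (Icc α β) :=
    (continuousOn_const.sub hpc).log fun y hy => (sub_pos.2 (hp01 y hy).2).ne'
  have hent : ContinuousOn (fun y => entS ((y + 1) / (y + γ))) (Icc α β) :=
    (hpc.mul hlog).neg.sub ((continuousOn_const.sub hpc).mul hlog')
  obtain ⟨M, hM⟩ := isCompact_Icc.bddAbove_image hlog.neg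
  obtain ⟨M', hM'⟩ := isCompact_Icc.bddAbove_image hlog'.neg
  have hsup : ∀ y ∈ Icc α β, entS ((y + 1) / (y + γ)) ≤
      sSup ((fun y => entS ((y + 1) / (y + γ))) '' Icc α β) := fun y hy =>
    le_csSup (isCompact_Icc.bddAbove_image hent) ⟨y, hy, rfl⟩
  have h0mem : (0 : ℝ) ∈ Icc α β := ⟨hα0, hβ0⟩
  refine hsplits.exists_measurableSet_dimH_le (M := max M M') (by simp [hf0, hf1]) hμI
    (forall_mem_image.2 hp01) (forall_mem_image.2 fun y hy => ⟨?_, ?_⟩) (forall_mem_image.2 hsup)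
    ((entS_nonneg (hp01 0 h0mem).1 (hp01 0 h0mem).2).trans (hsup 0 h0mem))
  · exact (hM ⟨y, hy, rfl⟩).trans (le_max_left _ _)
  · exact (hM' ⟨y, hy, rfl⟩).trans (le_max_right _ _)
end

section
/- Assume conditions (i) and (ii) both hold, and normalize d_0 = 1 (possible since Φ(cA; z) = Φ(A; z) for every constant c > 0 and conditions (A1)–(A3) are preserved under positive scaling of A_0 and A_1). Then f(x) = x/(−2c_0 x + 1 + 2c_0) for x ∈ [0,1], and μ_f has density x ↦ (1 + 2c_0)/(−2c_0 x + 1 + 2c_0)^2 with respect to Lebesgue measure on [0,1]; in particular μ_f is absolutely continuous with respect to Lebesgue measure. -/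
open MeasureTheory Filter Set Matrix

/-- A continuous function on `[0, 1]` that halves under both inverse branches of the doubling map
vanishes. -/
theorem eq_zero_of_halving {e : ℝ → ℝ} (hc : ContinuousOn e (Set.Icc 0 1))
    (h0 : ∀ x ∈ Set.Icc (0 : ℝ) (1 / 2), e x = e (2 * x) / 2)
    (h1 : ∀ x ∈ Set.Icc (1 / 2 : ℝ) 1, e x = e (2 * x - 1) / 2) :
    ∀ x ∈ Set.Icc (0 : ℝ) 1, e x = 0 := by
  obtain ⟨m, hm, hmax⟩ := isCompact_Icc.exists_isMaxOn
    (Set.nonempty_Icc.2 (zero_le_one' ℝ)) hc.abs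
  have hhalf : ∃ y ∈ Set.Icc (0 : ℝ) 1, e m = e y / 2 := by
    rcases le_total m (1 / 2) with h | h
    · exact ⟨2 * m, ⟨by linarith [hm.1], by linarith⟩, h0 m ⟨hm.1, h⟩⟩
    · exact ⟨2 * m - 1, ⟨by linarith, by linarith [hm.2]⟩, h1 m ⟨h, hm.2⟩⟩
  obtain ⟨y, hy, hey⟩ := hhalf
  have hym : |e y| ≤ |e m| := hmax hy
  have habs : |e m| = |e y| / 2 := by rw [hey, abs_div, abs_two]
  intro x hx
  have hxm : |e x| ≤ |e m| := hmax hx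
  exact abs_nonpos_iff.1 (by linarith)

theorem mobius_denom_pos {c x : ℝ} (hc : 0 < 1 + 2 * c) (hx : x ∈ Set.Icc (0 : ℝ) 1) :
    0 < -(2 * c) * x + 1 + 2 * c := by
  obtain ⟨h0, h1⟩ := hx
  rcases le_total 0 c with h | h <;> nlinarith

theorem mobius_inverse_denom_pos {c y : ℝ} (hc : 0 < 1 + 2 * c) (hy : y ∈ Set.Icc (0 : ℝ) 1) :
    0 < 1 + 2 * c * y := by
  obtain ⟨h0, h1⟩ := hy
  rcases le_total 0 c with h | h <;> nlinarith

/-- De Rham's equation for the normalised pair of Möbius maps has the Möbius solution. -/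
theorem deRham_eq_mobius {c : ℝ} (hc : 0 < 1 + 2 * c) {f : ℝ → ℝ}
    (hfc : ContinuousOn f (Set.Icc 0 1)) (hf : Set.MapsTo f (Set.Icc 0 1) (Set.Icc 0 1))
    (h0 : ∀ x ∈ Set.Icc (0 : ℝ) (1 / 2), f x = Phi (1 / 2) 0 c 1 (f (2 * x)))
    (h1 : ∀ x ∈ Set.Icc (1 / 2 : ℝ) 1,
      f x = Phi (4 * c + 1) 1 (2 * c) (2 + 2 * c) (f (2 * x - 1))) :
    ∀ x ∈ Set.Icc (0 : ℝ) 1, f x = x / (-(2 * c) * x + 1 + 2 * c) := by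
  have hpos : ∀ x ∈ Set.Icc (0 : ℝ) 1, 0 < 1 + 2 * c * f x :=
    fun x hx => mobius_inverse_denom_pos hc (hf hx)
  have key := eq_zero_of_halving (e := fun x => (1 + 2 * c) * f x / (1 + 2 * c * f x) - x)
    (((continuousOn_const.mul hfc).div (continuousOn_const.add (continuousOn_const.mul hfc))
      fun x hx => (hpos x hx).ne').sub continuousOn_id) ?_ ?_
  · intro x hx
    have hk := key x hx
    have hp := hpos x hx
    rw [eq_div_iff (mobius_denom_pos hc hx).ne']
    rw [sub_eq_zero, div_eq_iff hp.ne'] at hk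
    linarith
  · intro x hx
    have hx2 : 2 * x ∈ Set.Icc (0 : ℝ) 1 := ⟨by linarith [hx.1], by linarith [hx.2]⟩
    have hy := hf hx2
    have hp := hpos _ hx2
    simp only [h0 x hx, Phi]
    generalize f (2 * x) = y at *
    have hq : 0 < c * y + 1 := by nlinarith [hy.1]
    have hr : 1 + 2 * c * ((1 / 2 * y + 0) / (c * y + 1)) = (1 + 2 * c * y) / (c * y + 1) := by
      field_simp; ring
    rw [hr]
    field_simp
    ring
  · intro x hx
    have hx2 : 2 * x - 1 ∈ Set.Icc (0 : ℝ) 1 := ⟨by linarith [hx.1], by linarith [hx.2]⟩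
    have hy := hf hx2
    have hp := hpos _ hx2
    simp only [h1 x hx, Phi]
    generalize f (2 * x - 1) = y at *
    obtain ⟨D, hD⟩ : ∃ D, D = 2 * c * y + (2 + 2 * c) := ⟨_, rfl⟩
    have hq : 0 < D := by linarith
    have hr : 1 + 2 * c * (((4 * c + 1) * y + 1) / D) =
        2 * (1 + 2 * c) * (1 + 2 * c * y) / D := by
      field_simp
      rw [hD]
      ring
    rw [← hD, hr]
    field_simp
    ring

theorem hasDerivAt_mobius {c x : ℝ} (hx : -(2 * c) * x + 1 + 2 * c ≠ 0) :
    HasDerivAt (fun x => x / (-(2 * c) * x + 1 + 2 * c))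
      ((1 + 2 * c) / (-(2 * c) * x + 1 + 2 * c) ^ 2) x := by
  have hd : HasDerivAt (fun x => -(2 * c) * x + 1 + 2 * c) (-(2 * c)) x := by
    simpa using (((hasDerivAt_id x).const_mul (-(2 * c))).add_const 1).add_const (2 * c)
  refine ((hasDerivAt_id' x).fun_div hd hx).congr_deriv ?_
  ring

theorem lintegral_mobius_density {c t : ℝ} (hc : 0 < 1 + 2 * c) (ht : t ∈ Set.Icc (0 : ℝ) 1) :
    ∫⁻ x in Set.Icc 0 t, ENNReal.ofReal ((1 + 2 * c) / (-(2 * c) * x + 1 + 2 * c) ^ 2) =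
      ENNReal.ofReal (t / (-(2 * c) * t + 1 + 2 * c)) := by
  have hpos : ∀ x ∈ Set.Icc (0 : ℝ) t, 0 < -(2 * c) * x + 1 + 2 * c :=
    fun x hx => mobius_denom_pos hc ⟨hx.1, hx.2.trans ht.2⟩
  have hcont : ContinuousOn (fun x => (1 + 2 * c) / (-(2 * c) * x + 1 + 2 * c) ^ 2)
      (Set.Icc 0 t) :=
    continuousOn_const.div (by fun_prop) fun x hx => (pow_pos (hpos x hx) 2).ne'
  rw [← ofReal_integral_eq_lintegral_ofReal (hcont.integrableOn_compact isCompact_Icc)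
    (ae_of_all _ fun x => by positivity), integral_Icc_eq_integral_Ioc,
    ← intervalIntegral.integral_of_le ht.1,
    intervalIntegral.integral_eq_sub_of_hasDerivAt
      (f := fun x => x / (-(2 * c) * x + 1 + 2 * c))]
  · simp
  · intro x hx
    rw [Set.uIcc_of_le ht.1] at hx
    exact hasDerivAt_mobius (hpos x hx).ne'
  · exact ContinuousOn.intervalIntegrable (by rwa [Set.uIcc_of_le ht.1])

/-- A probability measure is determined by its distribution function on `[0, 1]`, if that goes
from `0` to `1`. -/
theorem eq_withDensity_of_cdf {μ : Measure ℝ} [IsProbabilityMeasure μ] {F : ℝ → ℝ}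
    {ρ : ℝ → ENNReal} (hF0 : F 0 = 0) (hF1 : F 1 = 1)
    (hμ : ∀ x ∈ Set.Icc (0 : ℝ) 1, μ (Set.Iic x) = ENNReal.ofReal (F x))
    (hρ : ∀ t ∈ Set.Icc (0 : ℝ) 1, ∫⁻ x in Set.Icc 0 t, ρ x = ENNReal.ofReal (F t)) :
    μ = (volume.restrict (Set.Icc 0 1)).withDensity ρ := by
  refine Measure.ext_of_Iic _ _ fun x => ?_
  rw [withDensity_apply _ measurableSet_Iic, Measure.restrict_restrict measurableSet_Iic]
  rcases lt_or_ge x 0 with hx | hx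
  · have hempty : Set.Iic x ∩ Set.Icc (0 : ℝ) 1 = ∅ :=
      Set.eq_empty_of_forall_notMem fun y hy => (hy.1.trans_lt hx).not_ge hy.2.1
    have hzero : μ (Set.Iic 0) = 0 := by simp [hμ 0 (by simp), hF0]
    simp [hempty, measure_mono_null (Set.Iic_subset_Iic.2 hx.le) hzero]
  · rcases le_total x 1 with hx1 | hx1
    · have hset : Set.Iic x ∩ Set.Icc (0 : ℝ) 1 = Set.Icc 0 x := by
        ext y
        simp only [Set.mem_inter_iff, Set.mem_Iic, Set.mem_Icc]
        constructor
        · exact fun h => ⟨h.2.1, h.1⟩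
        · exact fun h => ⟨h.2, h.1, h.2.trans hx1⟩
      rw [hset, hρ x ⟨hx, hx1⟩, hμ x ⟨hx, hx1⟩]
    · have hone : μ (Set.Iic 1) = 1 := by simp [hμ 1 (by simp), hF1]
      rw [Set.inter_eq_right.2 fun y hy => hy.2.trans hx1, hρ 1 (by simp), hF1,
        ENNReal.ofReal_one]
      exact le_antisymm prob_le_one (hone ▸ measure_mono (Set.Iic_subset_Iic.2 hx1))

theorem Phi_mul_left {k : ℝ} (hk : k ≠ 0) (a b c d z : ℝ) :
    Phi (k * a) (k * b) (k * c) (k * d) z = Phi a b c d z := by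
  simp only [Phi, mul_assoc, ← mul_add]
  exact mul_div_mul_left _ _ hk

theorem stmt2
    (a0 b0 c0 d0 a1 b1 c1 d1 : ℝ)
    (hb0 : b0 = 0)
    (hA1a : 0 < (a0 + b0) / (c0 + d0))
    (hA1b : (a0 + b0) / (c0 + d0) = b1 / d1)
    (hA1c : b1 / d1 < (a1 + b1) / (c1 + d1))
    (hA1d : (a1 + b1) / (c1 + d1) = 1)
    (hA20 : 0 < a0 * d0 - b0 * c0)
    (hA21 : 0 < a1 * d1 - b1 * c1)
    (hA30 : Real.sqrt (a0 * d0 - b0 * c0) < min d0 (c0 + d0))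
    (hA31 : Real.sqrt (a1 * d1 - b1 * c1) < min d1 (c1 + d1))
    (f : ℝ → ℝ)
    (hfc : ContinuousOn f (Set.Icc 0 1))
    (hfm : StrictMonoOn f (Set.Icc 0 1))
    (hf0 : f 0 = 0) (hf1 : f 1 = 1)
    (hdR0 : ∀ x ∈ Set.Icc (0 : ℝ) (1 / 2), f x = Phi a0 b0 c0 d0 (f (2 * x)))
    (hdR1 : ∀ x ∈ Set.Icc (1 / 2 : ℝ) 1, f x = Phi a1 b1 c1 d1 (f (2 * x - 1)))
    (μf : Measure ℝ) [IsProbabilityMeasure μf]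
    (hμf : ∀ x ∈ Set.Icc (0 : ℝ) 1, μf (Set.Iic x) = ENNReal.ofReal (f x))
    (hd0 : d0 = 1)
    (hi : (c0 + d0 - 2 * a0) * (d0 - a0) = a0 * c0)
    (hii : (a1 - 2 * c1) * (d1 - 2 * b1) = b1 * c1) :
    (∀ x ∈ Set.Icc (0 : ℝ) 1, f x = x / (-(2 * c0) * x + 1 + 2 * c0)) ∧
    μf = (volume.restrict (Set.Icc 0 1)).withDensity
      (fun x => ENNReal.ofReal ((1 + 2 * c0) / (-(2 * c0) * x + 1 + 2 * c0) ^ 2)) ∧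
    μf ≪ (volume : Measure ℝ) := by
  subst hb0 hd0
  simp only [add_zero, mul_one, zero_mul, sub_zero] at *
  rw [lt_min_iff] at hA30 hA31
  have hs := Real.sq_sqrt hA20.le
  have hs0 := Real.sqrt_pos.2 hA20
  have ha0 : a0 = 1 / 2 := by
    have hfac : (1 - 2 * a0) * (c0 + 1 - a0) = 0 := by linear_combination hi
    rcases mul_eq_zero.1 hfac with h | h
    · linarith
    · nlinarith [hA30.1, hA30.2]
  subst ha0
  have hc : 0 < 1 + 2 * c0 := by nlinarith [hA30.2]
  have hd1 : 0 < d1 := (Real.sqrt_nonneg _).trans_lt hA31.1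
  have hcd1 : 0 < c1 + d1 := (Real.sqrt_nonneg _).trans_lt hA31.2
  have hd1b : d1 = b1 * (2 + 2 * c0) := by
    rw [div_eq_div_iff (by linarith) hd1.ne'] at hA1b
    linarith
  have hb1 : 0 < b1 := pos_of_mul_pos_left (hd1b ▸ hd1) (by linarith)
  have hsum : a1 + b1 = c1 + d1 := by rwa [div_eq_one_iff_eq hcd1.ne'] at hA1d
  have hc1 : c1 = b1 * (2 * c0) := by
    have hfac : (d1 - b1) * (d1 - 2 * b1 - c1) = 0 := by
      linear_combination hii - (d1 - 2 * b1) * hsum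
    rcases mul_eq_zero.1 hfac with h | h
    · nlinarith [mul_pos hb1 hc]
    · linarith
  have ha1 : a1 = b1 * (4 * c0 + 1) := by linarith
  have hf : Set.MapsTo f (Set.Icc 0 1) (Set.Icc 0 1) := fun x hx =>
    ⟨hf0 ▸ hfm.monotoneOn (by simp) hx hx.1, hf1 ▸ hfm.monotoneOn hx (by simp) hx.2⟩
  have hformula := deRham_eq_mobius hc hfc hf hdR0 fun x hx => by
    rw [hdR1 x hx, ← Phi_mul_left hb1.ne' (4 * c0 + 1), ← ha1, ← hc1, ← hd1b, mul_one]
  have hdensity := eq_withDensity_of_cdf hf0 hf1 hμf fun t ht => by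
    rw [hformula t ht]
    exact lintegral_mobius_density hc ht
  refine ⟨hformula, hdensity, ?_⟩
  rw [hdensity]
  exact (withDensity_absolutelyContinuous _ _).trans Measure.absolutelyContinuous_restrict
end

section
/- If condition (i) fails or condition (ii) fails, then there exists a Borel set K_1 ⊆ [0,1] with μ_f(K_1) = 1 and dim_H(K_1) < 1; in particular μ_f is singular with respect to Lebesgue measure. -/
open MeasureTheory Filter Set Matrix

section TransferOperator

lemma sqrt_add_sqrt_le_sqrt_two {p q : ℝ} (hp : 0 ≤ p) (hq : 0 ≤ q) (h : p + q = 1) :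
    √p + √q ≤ √2 := by
  refine Real.le_sqrt_of_sq_le ?_
  nlinarith [Real.sq_sqrt hp, Real.sq_sqrt hq, sq_nonneg (√p - √q)]

lemma eq_half_of_sqrt_two_le {p q : ℝ} (hp : 0 ≤ p) (hq : 0 ≤ q) (h : p + q = 1)
    (h2 : √2 ≤ √p + √q) : p = 1 / 2 := by
  have hle := sqrt_add_sqrt_le_sqrt_two hp hq h
  have hsq : (√p + √q) ^ 2 = 2 := by
    rw [le_antisymm hle h2]
    exact Real.sq_sqrt (by norm_num)
  have hp' := Real.sq_sqrt hp
  have hq' := Real.sq_sqrt hq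
  have hd : (√p - √q) ^ 2 = 0 := by nlinarith
  have heq : √p = √q := sub_eq_zero.mp (pow_eq_zero_iff two_ne_zero |>.mp hd)
  rw [heq] at hp'
  linarith

/-- One step of the transfer operator with weights `√P`, `√Q` and branches `G`, `H`. -/
noncomputable def sqrtTransfer (P Q G H : ℝ → ℝ) (u : ℝ → ℝ) (t : ℝ) : ℝ :=
  √(P t) * u (G t) + √(Q t) * u (H t)

variable {P Q G H : ℝ → ℝ} {K : Set ℝ}

/-- If the weights cannot be balanced along two consecutive steps, then two steps of the
transfer operator contract by strictly more than the trivial factor `2`. -/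
lemma exists_sqrtTransfer_two_lt (hK : IsCompact K) (hne : K.Nonempty)
    (hP : ContinuousOn P K) (hQ : ContinuousOn Q K)
    (hG : ContinuousOn G K) (hH : ContinuousOn H K)
    (hGK : MapsTo G K K) (hHK : MapsTo H K K)
    (hP0 : ∀ t ∈ K, 0 < P t) (hQ0 : ∀ t ∈ K, 0 < Q t) (hPQ : ∀ t ∈ K, P t + Q t = 1)
    (hbal : ∀ t ∈ K, P t = 1 / 2 → P (G t) = 1 / 2 → P (H t) = 1 / 2 → False) :
    ∃ κ : ℝ, 1 ≤ κ ∧ κ < 2 ∧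
      ∀ t ∈ K, sqrtTransfer P Q G H (sqrtTransfer P Q G H fun _ => 1) t ≤ κ := by
  set φ : ℝ → ℝ := sqrtTransfer P Q G H fun _ => 1 with hφ
  have hφe : ∀ t, φ t = √(P t) + √(Q t) := fun t => by simp [hφ, sqrtTransfer]
  have hφc : ContinuousOn φ K := by
    refine (hP.sqrt.add hQ.sqrt).congr fun t _ => ?_
    simp [hφe]
  have hφle : ∀ t ∈ K, φ t ≤ √2 := fun t ht => by
    rw [hφe]
    exact sqrt_add_sqrt_le_sqrt_two (hP0 t ht).le (hQ0 t ht).le (hPQ t ht)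
  have hφeq : ∀ t ∈ K, √2 ≤ φ t → P t = 1 / 2 := fun t ht h => by
    rw [hφe] at h
    exact eq_half_of_sqrt_two_le (hP0 t ht).le (hQ0 t ht).le (hPQ t ht) h
  have hSc : ContinuousOn (sqrtTransfer P Q G H φ) K :=
    (hP.sqrt.mul (hφc.comp hG hGK)).add (hQ.sqrt.mul (hφc.comp hH hHK))
  have hlt : ∀ t ∈ K, sqrtTransfer P Q G H φ t < 2 := by
    intro t ht
    have h2 : √2 * √2 = (2 : ℝ) := Real.mul_self_sqrt (by norm_num)
    have hs2 : (0 : ℝ) < √2 := Real.sqrt_pos.mpr (by norm_num)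
    have hp := Real.sqrt_pos.mpr (hP0 t ht)
    have hq := Real.sqrt_pos.mpr (hQ0 t ht)
    have h1 := hφle t ht
    have hg := hφle _ (hGK ht)
    have hh := hφle _ (hHK ht)
    have e1 := hφe t
    have m1 := mul_le_mul_of_nonneg_left hg hp.le
    have m2 := mul_le_mul_of_nonneg_left hh hq.le
    have m3 := mul_le_mul_of_nonneg_right h1 hs2.le
    unfold sqrtTransfer
    by_contra! hcon
    refine hbal t ht (hφeq t ht ?_) (hφeq _ (hGK ht) ?_) (hφeq _ (hHK ht) ?_)
    · exact le_of_mul_le_mul_right (by nlinarith) hs2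
    · exact le_of_mul_le_mul_left (by nlinarith) hp
    · exact le_of_mul_le_mul_left (by nlinarith) hq
  obtain ⟨m, hm, hmax⟩ := hK.exists_isMaxOn hne hSc
  exact ⟨max 1 (sqrtTransfer P Q G H φ m), le_max_left _ _, max_lt (by norm_num) (hlt m hm),
    fun t ht => (hmax ht).trans (le_max_right _ _)⟩

lemma sqrtTransfer_mono {u v : ℝ → ℝ} (hGK : MapsTo G K K) (hHK : MapsTo H K K)
    (huv : ∀ t ∈ K, u t ≤ v t) : ∀ t ∈ K, sqrtTransfer P Q G H u t ≤ sqrtTransfer P Q G H v t := by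
  intro t ht
  exact add_le_add (mul_le_mul_of_nonneg_left (huv _ (hGK ht)) (Real.sqrt_nonneg _))
    (mul_le_mul_of_nonneg_left (huv _ (hHK ht)) (Real.sqrt_nonneg _))

lemma iterate_sqrtTransfer_le {κ : ℝ} {T : ℕ → ℝ → ℝ} (hκ0 : 0 ≤ κ)
    (hGK : MapsTo G K K) (hHK : MapsTo H K K)
    (hκ : ∀ t ∈ K, sqrtTransfer P Q G H (sqrtTransfer P Q G H fun _ => 1) t ≤ κ)
    (hT0 : ∀ t ∈ K, T 0 t = 1)
    (hT : ∀ n, ∀ t ∈ K, T (n + 1) t = sqrtTransfer P Q G H (T n) t) (n : ℕ) :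
    ∀ t ∈ K, T (2 * n) t ≤ κ ^ n := by
  induction n with
  | zero => intro t ht; simp [hT0 t ht]
  | succ n ih =>
    intro t ht
    have hstep : ∀ s ∈ K, T (2 * n + 1) s ≤
        sqrtTransfer P Q G H (fun _ => κ ^ n) s := fun s hs => by
      rw [hT _ s hs]
      exact sqrtTransfer_mono hGK hHK ih s hs
    have h2 := sqrtTransfer_mono (P := P) (Q := Q) hGK hHK hstep t ht
    rw [show 2 * (n + 1) = 2 * n + 1 + 1 by ring, hT _ t ht]
    refine h2.trans ?_
    have := mul_le_mul_of_nonneg_left (hκ t ht) (pow_nonneg hκ0 n)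
    simp only [sqrtTransfer] at this ⊢
    rw [pow_succ]
    linarith

end TransferOperator

section Dimension

/-- The half-open interval of level `n` and index `k` in the partition of `(0, 1]` into
intervals of length `4⁻ⁿ`. -/
def quadIoc (n k : ℕ) : Set ℝ := Ioc ((k : ℝ) / 4 ^ n) (((k : ℝ) + 1) / 4 ^ n)

/-- The increment of `f` over `quadIoc n k`. -/
noncomputable def quadInc (f : ℝ → ℝ) (n k : ℕ) : ℝ :=
  f (((k + 1 : ℕ) : ℝ) / 4 ^ n) - f ((k : ℝ) / 4 ^ n)

lemma exists_mem_quadIoc {x : ℝ} (hx : x ∈ Ioc (0 : ℝ) 1) (n : ℕ) :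
    ∃ k < 4 ^ n, x ∈ quadIoc n k := by
  have h4 : (0 : ℝ) < 4 ^ n := by positivity
  have hpos : 0 < ⌈x * 4 ^ n⌉₊ := Nat.ceil_pos.mpr (mul_pos hx.1 h4)
  obtain ⟨k, hk⟩ : ∃ k, ⌈x * 4 ^ n⌉₊ = k + 1 := ⟨_, (Nat.succ_pred_eq_of_pos hpos).symm⟩
  refine ⟨k, ?_, ?_, ?_⟩
  · have : ⌈x * 4 ^ n⌉₊ ≤ 4 ^ n := by
      rw [Nat.ceil_le]
      push_cast
      nlinarith [hx.2]
    omega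
  · rw [div_lt_iff₀ h4]
    exact Nat.lt_ceil.mp (by omega)
  · rw [le_div_iff₀ h4]
    have := Nat.le_ceil (x * 4 ^ n)
    rw [hk] at this
    exact_mod_cast this

lemma quad_mem_Icc {n k : ℕ} (hk : k ≤ 4 ^ n) : (k : ℝ) / 4 ^ n ∈ Icc (0 : ℝ) 1 :=
  ⟨by positivity, div_le_one_of_le₀ (by exact_mod_cast hk) (by positivity)⟩

lemma measure_quadIoc {f : ℝ → ℝ} {μ : Measure ℝ} [IsFiniteMeasure μ]
    (hf : MonotoneOn f (Icc 0 1)) (hf0 : f 0 = 0)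
    (hμ : ∀ x ∈ Icc (0 : ℝ) 1, μ (Iic x) = ENNReal.ofReal (f x)) {n k : ℕ} (hk : k < 4 ^ n) :
    μ (quadIoc n k) = ENNReal.ofReal (quadInc f n k) := by
  have ha := quad_mem_Icc hk.le
  have hb := quad_mem_Icc (Nat.succ_le_of_lt hk)
  have hle : (k : ℝ) / 4 ^ n ≤ ((k + 1 : ℕ) : ℝ) / 4 ^ n := by
    gcongr
    omega
  have h0 : 0 ≤ f ((k : ℝ) / 4 ^ n) := by
    rw [← hf0]
    exact hf (left_mem_Icc.mpr zero_le_one) ha ha.1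
  have heq : quadIoc n k = Iic (((k + 1 : ℕ) : ℝ) / 4 ^ n) \ Iic ((k : ℝ) / 4 ^ n) := by
    rw [Iic_sdiff_Iic]
    simp [quadIoc]
  rw [heq, measure_sdiff (Iic_subset_Iic.mpr hle) measurableSet_Iic.nullMeasurableSet
    (measure_ne_top _ _), hμ _ ha, hμ _ hb, quadInc, ENNReal.ofReal_sub _ h0]

lemma sum_quadInc (f : ℝ → ℝ) (n : ℕ) :
    ∑ k ∈ Finset.range (4 ^ n), quadInc f n k = f 1 - f 0 := by
  have := Finset.sum_range_sub (fun k : ℕ => f ((k : ℝ) / 4 ^ n)) (4 ^ n)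
  simpa [quadInc] using this

lemma quadInc_nonneg {f : ℝ → ℝ} (hf : MonotoneOn f (Icc 0 1)) {n k : ℕ} (hk : k < 4 ^ n) :
    0 ≤ quadInc f n k := by
  refine sub_nonneg.mpr (hf (quad_mem_Icc hk.le) (quad_mem_Icc (Nat.succ_le_of_lt hk)) ?_)
  gcongr
  omega

/-- If at every level `n` a set is covered by at most `σ⁻²ⁿ` intervals of length `4⁻ⁿ`, then its
Hausdorff dimension is at most `s`, where `4⁻ˢ = σ²`. -/
lemma dimH_le_of_quad_cover {A : Set ℝ} {σ : ℝ} {s : NNReal}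
    (hs : ((1 / 4 : ℝ)) ^ (s : ℝ) = σ ^ 2) (J : ℕ → Finset ℕ)
    (hJ : ∀ n, ((J n).card : ℝ) * (σ ^ n) ^ 2 ≤ 1)
    (hA : ∀ᶠ n in atTop, A ⊆ ⋃ k ∈ J n, quadIoc n k) : dimH A ≤ s := by
  refine dimH_le_of_hausdorffMeasure_ne_top (ne_top_of_le_ne_top ENNReal.one_ne_top ?_)
  have hdiam : ∀ n k, Metric.ediam (quadIoc n k) = ENNReal.ofReal ((1 / 4) ^ n) := by
    intro n k
    rw [quadIoc, Real.ediam_Ioc]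
    rw [← sub_div, add_sub_cancel_left, _root_.one_div_pow]
  refine (Measure.hausdorffMeasure_le_liminf_sum (ι := fun n => J n) (s : ℝ) A
    (l := atTop) (fun n : ℕ => ENNReal.ofReal ((1 / 4) ^ n)) ?_ (fun n k => quadIoc n k) ?_ ?_).trans
    ?_
  · have := tendsto_pow_atTop_nhds_zero_of_lt_one (r := (1 / 4 : ℝ)) (by norm_num) (by norm_num)
    simpa using ENNReal.tendsto_ofReal this
  · exact Eventually.of_forall fun n k => (hdiam n k).le
  · filter_upwards [hA] with n hn
    rw [iUnion_subtype]
    exact hn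
  · have hle : ∀ n : ℕ, ∑ k : J n, Metric.ediam (quadIoc n k) ^ (s : ℝ) ≤ 1 := by
      intro n
      simp only [hdiam]
      rw [Finset.sum_const, Finset.card_univ, Fintype.card_coe, nsmul_eq_mul,
        ENNReal.ofReal_rpow_of_pos (by positivity), ← ENNReal.ofReal_natCast,
        ← ENNReal.ofReal_mul (by positivity), ← ENNReal.ofReal_one]
      refine ENNReal.ofReal_le_ofReal ?_
      have : (((1 / 4 : ℝ)) ^ n) ^ (s : ℝ) = (σ ^ n) ^ 2 := by
        rw [← Real.rpow_natCast, ← Real.rpow_mul (by norm_num), mul_comm,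
          Real.rpow_mul (by norm_num), hs, Real.rpow_natCast, ← pow_mul, ← pow_mul, mul_comm]
      rw [this]
      exact hJ n
    calc _ ≤ liminf (fun _ : ℕ => (1 : ENNReal)) atTop :=
          liminf_le_liminf (Eventually.of_forall hle)
      _ = 1 := by simp

lemma exists_dimH_lt_one_of_sum_sqrt_le {f : ℝ → ℝ} {μ : Measure ℝ} [IsProbabilityMeasure μ]
    (hf : MonotoneOn f (Icc 0 1)) (hf0 : f 0 = 0) (hf1 : f 1 = 1)
    (hμ : ∀ x ∈ Icc (0 : ℝ) 1, μ (Iic x) = ENNReal.ofReal (f x))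
    {κ : ℝ} (hκ1 : 1 ≤ κ) (hκ2 : κ < 2)
    (hsum : ∀ n, ∑ k ∈ Finset.range (4 ^ n), √(quadInc f n k) ≤ κ ^ n) :
    ∃ K : Set ℝ, MeasurableSet K ∧ K ⊆ Icc 0 1 ∧ μ K = 1 ∧ dimH K < 1 := by
  have hκ0 : 0 < κ := by linarith
  obtain ⟨σ, hσ1, hσ2⟩ : ∃ σ : ℝ, 1 / 2 < σ ∧ σ < 1 / κ :=
    exists_between (one_div_lt_one_div_of_lt hκ0 hκ2)
  have hσ0 : 0 < σ := by linarith
  have hσκ : σ * κ < 1 := (lt_div_iff₀ hκ0).mp hσ2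
  have hσlt : σ < 1 := by nlinarith
  obtain ⟨s, hs, hs1⟩ : ∃ s : NNReal, ((1 / 4 : ℝ)) ^ (s : ℝ) = σ ^ 2 ∧ s < 1 := by
    have hlog := Real.rpow_logb (b := 1 / 4) (x := σ ^ 2) (by norm_num) (by norm_num)
      (by positivity)
    have h0 : 0 ≤ Real.logb (1 / 4) (σ ^ 2) :=
      Real.logb_nonneg_of_base_lt_one (by norm_num) (by norm_num) (by positivity) (by nlinarith)
    refine ⟨⟨_, h0⟩, hlog, ?_⟩
    change Real.logb (1 / 4) (σ ^ 2) < 1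
    rw [Real.logb_lt_iff_lt_rpow_of_base_lt_one (by norm_num) (by norm_num) (by positivity),
      Real.rpow_one]
    nlinarith
  let bad : ℕ → Finset ℕ := fun n => {k ∈ Finset.range (4 ^ n) | quadInc f n k < (σ ^ n) ^ 2}
  let good : ℕ → Finset ℕ := fun n => {k ∈ Finset.range (4 ^ n) | ¬ quadInc f n k < (σ ^ n) ^ 2}
  let B : ℕ → Set ℝ := fun n => ⋃ k ∈ bad n, quadIoc n k
  have hBmeas : ∀ n, MeasurableSet (B n) := fun n =>
    Finset.measurableSet_biUnion _ fun _ _ => measurableSet_Ioc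
  have hBle : ∀ n, μ (B n) ≤ ENNReal.ofReal ((σ * κ) ^ n) := by
    intro n
    calc μ (B n) ≤ ∑ k ∈ bad n, μ (quadIoc n k) := measure_biUnion_finset_le _ _
      _ = ∑ k ∈ bad n, ENNReal.ofReal (quadInc f n k) :=
          Finset.sum_congr rfl fun k hk => measure_quadIoc hf hf0 hμ
            (Finset.mem_range.mp (Finset.mem_filter.mp hk).1)
      _ = ENNReal.ofReal (∑ k ∈ bad n, quadInc f n k) :=
          (ENNReal.ofReal_sum_of_nonneg fun k hk => quadInc_nonneg hf
            (Finset.mem_range.mp (Finset.mem_filter.mp hk).1)).symm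
      _ ≤ ENNReal.ofReal ((σ * κ) ^ n) := by
        refine ENNReal.ofReal_le_ofReal ?_
        calc ∑ k ∈ bad n, quadInc f n k ≤ ∑ k ∈ bad n, σ ^ n * √(quadInc f n k) := by
              refine Finset.sum_le_sum fun k hk => ?_
              obtain ⟨hk1, hk2⟩ := Finset.mem_filter.mp hk
              have hnn := quadInc_nonneg hf (Finset.mem_range.mp hk1)
              have hsq : √(quadInc f n k) ≤ σ ^ n :=
                Real.sqrt_le_iff.mpr ⟨by positivity, hk2.le⟩
              nlinarith [Real.mul_self_sqrt hnn, Real.sqrt_nonneg (quadInc f n k)]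
          _ ≤ ∑ k ∈ Finset.range (4 ^ n), σ ^ n * √(quadInc f n k) :=
              Finset.sum_le_sum_of_subset_of_nonneg (Finset.filter_subset _ _)
                fun _ _ _ => by positivity
          _ ≤ (σ * κ) ^ n := by
              rw [← Finset.mul_sum, mul_pow]
              exact mul_le_mul_of_nonneg_left (hsum n) (by positivity)
  have hlim : μ (limsup B atTop) = 0 := by
    refine measure_limsup_atTop_eq_zero (ne_top_of_le_ne_top ?_ (ENNReal.tsum_le_tsum hBle))
    rw [← ENNReal.ofReal_tsum_of_nonneg (fun n => by positivity)
      (summable_geometric_of_lt_one (by positivity) hσκ)]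
    exact ENNReal.ofReal_ne_top
  have hcard : ∀ n, ((good n).card : ℝ) * (σ ^ n) ^ 2 ≤ 1 := by
    intro n
    calc ((good n).card : ℝ) * (σ ^ n) ^ 2 = ∑ k ∈ good n, (σ ^ n) ^ 2 := by simp
      _ ≤ ∑ k ∈ good n, quadInc f n k :=
          Finset.sum_le_sum fun k hk => not_lt.mp (Finset.mem_filter.mp hk).2
      _ ≤ ∑ k ∈ Finset.range (4 ^ n), quadInc f n k :=
          Finset.sum_le_sum_of_subset_of_nonneg (Finset.filter_subset _ _)
            fun k hk _ => quadInc_nonneg hf (Finset.mem_range.mp hk)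
      _ = 1 := by rw [sum_quadInc, hf0, hf1, sub_zero]
  have hmeas : MeasurableSet (limsup B atTop) := MeasurableSet.measurableSet_limsup hBmeas
  refine ⟨Ioc 0 1 \ limsup B atTop, measurableSet_Ioc.diff hmeas,
    sdiff_subset.trans Ioc_subset_Icc_self, ?_, ?_⟩
  · rw [measure_sdiff_null hlim]
    have h := measure_quadIoc hf hf0 hμ (n := 0) (k := 0) (by norm_num)
    simpa [quadIoc, quadInc, hf0, hf1] using h
  · have hsub : Ioc (0 : ℝ) 1 \ limsup B atTop ⊆
        ⋃ N : ℕ, {x | x ∈ Ioc (0 : ℝ) 1 ∧ ∀ n ≥ N, x ∉ B n} := by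
      rintro x ⟨hx, hxB⟩
      rw [mem_limsup_iff_frequently_mem, not_frequently, eventually_atTop] at hxB
      obtain ⟨N, hN⟩ := hxB
      exact mem_iUnion.mpr ⟨N, hx, hN⟩
    refine lt_of_le_of_lt ((dimH_mono hsub).trans ?_) (ENNReal.coe_lt_one_iff.mpr hs1)
    rw [dimH_iUnion]
    refine iSup_le fun N => dimH_le_of_quad_cover hs good hcard ?_
    filter_upwards [eventually_ge_atTop N] with n hn x hx
    obtain ⟨k, hk, hxk⟩ := exists_mem_quadIoc hx.1 n
    have hxn := hx.2 n hn
    simp only [B, mem_iUnion, not_exists] at hxn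
    refine mem_iUnion₂.mpr ⟨k, ?_, hxk⟩
    refine Finset.mem_filter.mpr ⟨Finset.mem_range.mpr hk, fun hlt => hxn k ?_ hxk⟩
    exact Finset.mem_filter.mpr ⟨Finset.mem_range.mpr hk, hlt⟩

lemma volume_eq_zero_of_dimH_lt_one {K : Set ℝ} (hK : dimH K < 1) : volume K = 0 := by
  rw [← hausdorffMeasure_real]
  have := hausdorffMeasure_of_dimH_lt (d := 1) (s := K) (by simpa using hK)
  simpa using this

end Dimension

section Moebius

/-- The length of the image of `[u, v]` under a Möbius map with denominator `t z + 1`, relative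
to the length of the image of `[0, 1]`. -/
noncomputable def relLength (t u v : ℝ) : ℝ := (1 + t) * (v - u) / ((1 + t * u) * (1 + t * v))

/-- The sum of the square roots of the relative lengths of the dyadic images of level `n`. -/
noncomputable def sqrtLengthSum (f : ℝ → ℝ) (n : ℕ) (t : ℝ) : ℝ :=
  ∑ k ∈ Finset.range (2 ^ n), √(relLength t (f ((k : ℝ) / 2 ^ n)) (f (((k + 1 : ℕ) : ℝ) / 2 ^ n)))

lemma affine_pos_of_mem_Icc {c d z : ℝ} (hd : 0 < d) (hs : 0 < c + d)
    (hz : z ∈ Icc (0 : ℝ) 1) : 0 < c * z + d := by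
  rcases hz.1.eq_or_lt with rfl | hz0
  · simpa using hd
  · nlinarith [mul_pos hz0 hs, mul_nonneg (sub_nonneg.mpr hz.2) hd.le]

lemma one_add_mul_pos {g z : ℝ} (hg : -1 < g) (hz : z ∈ Icc (0 : ℝ) 1) : 0 < 1 + g * z := by
  linarith [affine_pos_of_mem_Icc one_pos (by linarith : 0 < g + 1) hz]

lemma relLength_Phi {a b c d t u v P g : ℝ} (hu : 0 < c * u + d) (hv : 0 < c * v + d)
    (hbt : 0 < b * t + d) (hgu : 0 < 1 + g * u) (hgv : 0 < 1 + g * v)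
    (hg : g * (b * t + d) = a * t + c)
    (hP : P * ((b * t + d) * ((1 + g) * (b * t + d))) = (1 + t) * (a * d - b * c)) :
    relLength t (Phi a b c d u) (Phi a b c d v) = P * relLength g u v := by
  have h1 : ∀ z, 0 < c * z + d →
      1 + t * Phi a b c d z = (b * t + d) * (1 + g * z) / (c * z + d) := by
    intro z hz
    have hz' := hz.ne'
    rw [Phi, eq_div_iff hz']
    linear_combination t * div_mul_cancel₀ (a * z + b) hz' - z * hg
  have hu' := hu.ne'
  have hv' := hv.ne'
  have hbt' := hbt.ne'
  have hgu' := hgu.ne'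
  have hgv' := hgv.ne'
  have h2 : Phi a b c d v - Phi a b c d u =
      (a * d - b * c) * (v - u) / ((c * u + d) * (c * v + d)) := by
    rw [Phi, Phi, div_sub_div _ _ hv' hu']
    congr 1 <;> ring
  rw [relLength, relLength, h1 u hu, h1 v hv, h2]
  calc _ = (1 + t) * (a * d - b * c) * (v - u) /
        ((b * t + d) ^ 2 * ((1 + g * u) * (1 + g * v))) := by
        field_simp
    _ = _ := by
        rw [← hP]
        field_simp

lemma sqrtLengthSum_zero {f : ℝ → ℝ} (hf0 : f 0 = 0) (hf1 : f 1 = 1) {t : ℝ} (ht : -1 < t) :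
    sqrtLengthSum f 0 t = 1 := by
  have : 1 + t ≠ 0 := by linarith
  simp [sqrtLengthSum, relLength, hf0, hf1, this]

/-- De Rham's equation makes `sqrtLengthSum` satisfy a transfer recursion. -/
lemma sqrtLengthSum_succ {a₀ b₀ c₀ d₀ a₁ b₁ c₁ d₁ t g h p q : ℝ} {f : ℝ → ℝ}
    (hf : ∀ x ∈ Icc (0 : ℝ) 1, f x ∈ Icc (0 : ℝ) 1)
    (hf₀ : ∀ x ∈ Icc (0 : ℝ) (1 / 2), f x = Phi a₀ b₀ c₀ d₀ (f (2 * x)))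
    (hf₁ : ∀ x ∈ Icc (1 / 2 : ℝ) 1, f x = Phi a₁ b₁ c₁ d₁ (f (2 * x - 1)))
    (hden₀ : ∀ z ∈ Icc (0 : ℝ) 1, 0 < c₀ * z + d₀) (hden₁ : ∀ z ∈ Icc (0 : ℝ) 1, 0 < c₁ * z + d₁)
    (ht₀ : 0 < b₀ * t + d₀) (ht₁ : 0 < b₁ * t + d₁) (hg1 : -1 < g) (hh1 : -1 < h)
    (hg : g * (b₀ * t + d₀) = a₀ * t + c₀) (hh : h * (b₁ * t + d₁) = a₁ * t + c₁)
    (hp0 : 0 ≤ p) (hq0 : 0 ≤ q)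
    (hp : p * ((b₀ * t + d₀) * ((1 + g) * (b₀ * t + d₀))) = (1 + t) * (a₀ * d₀ - b₀ * c₀))
    (hq : q * ((b₁ * t + d₁) * ((1 + h) * (b₁ * t + d₁))) = (1 + t) * (a₁ * d₁ - b₁ * c₁))
    (n : ℕ) :
    sqrtLengthSum f (n + 1) t = √p * sqrtLengthSum f n g + √q * sqrtLengthSum f n h := by
  have h2 : (0 : ℝ) < 2 ^ n := by positivity
  have hmem : ∀ k : ℕ, k ≤ 2 ^ n → (k : ℝ) / 2 ^ n ∈ Icc (0 : ℝ) 1 := fun k hk =>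
    ⟨by positivity, div_le_one_of_le₀ (by exact_mod_cast hk) (by positivity)⟩
  have hleft : ∀ k : ℕ, k ≤ 2 ^ n →
      f ((k : ℝ) / 2 ^ (n + 1)) = Phi a₀ b₀ c₀ d₀ (f ((k : ℝ) / 2 ^ n)) := by
    intro k hk
    have e : (k : ℝ) / 2 ^ n = 2 * ((k : ℝ) / 2 ^ (n + 1)) := by
      rw [pow_succ]
      field_simp
    have hm := hmem k hk
    rw [e] at hm ⊢
    exact hf₀ _ ⟨by linarith [hm.1], by linarith [hm.2]⟩
  have hright : ∀ k : ℕ, k ≤ 2 ^ n →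
      f (((2 ^ n + k : ℕ) : ℝ) / 2 ^ (n + 1)) = Phi a₁ b₁ c₁ d₁ (f ((k : ℝ) / 2 ^ n)) := by
    intro k hk
    have e : (k : ℝ) / 2 ^ n = 2 * (((2 ^ n + k : ℕ) : ℝ) / 2 ^ (n + 1)) - 1 := by
      push_cast
      rw [pow_succ]
      field_simp
      ring
    have hm := hmem k hk
    rw [e] at hm ⊢
    exact hf₁ _ ⟨by linarith [hm.1], by linarith [hm.2]⟩
  unfold sqrtLengthSum
  rw [pow_succ 2 n, mul_two, Finset.sum_range_add, Finset.mul_sum, Finset.mul_sum]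
  congr 1
  · refine Finset.sum_congr rfl fun k hk => ?_
    have hk' := Finset.mem_range.mp hk
    have hu := hf _ (hmem k hk'.le)
    have hv := hf _ (hmem (k + 1) hk')
    rw [hleft k hk'.le, hleft (k + 1) hk', ← Real.sqrt_mul hp0,
      relLength_Phi (hden₀ _ hu) (hden₀ _ hv) ht₀ (one_add_mul_pos hg1 hu)
        (one_add_mul_pos hg1 hv) hg hp]
  · refine Finset.sum_congr rfl fun k hk => ?_
    have hk' := Finset.mem_range.mp hk
    have hu := hf _ (hmem k hk'.le)
    have hv := hf _ (hmem (k + 1) hk')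
    rw [add_assoc, hright k hk'.le, hright (k + 1) hk', ← Real.sqrt_mul hq0,
      relLength_Phi (hden₁ _ hu) (hden₁ _ hv) ht₁ (one_add_mul_pos hh1 hu)
        (one_add_mul_pos hh1 hv) hh hq]

lemma sqrtLengthSum_two_mul_zero (f : ℝ → ℝ) (n : ℕ) :
    sqrtLengthSum f (2 * n) 0 = ∑ k ∈ Finset.range (4 ^ n), √(quadInc f n k) := by
  unfold sqrtLengthSum
  rw [pow_mul, pow_mul]
  norm_num [relLength, quadInc]

/-- For a solution of de Rham's equation, the square roots of the increments over `4`-adic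
intervals sum to strictly less than the trivial bound `2 ^ n`, exponentially in `n`, unless both
balance conditions hold. -/
lemma exists_sum_sqrt_quadInc_le {a0 c0 d0 a1 b1 c1 d1 : ℝ} {f : ℝ → ℝ}
    (hd0 : 0 < d0) (hs0 : 0 < c0 + d0) (hd1 : 0 < d1) (hs1 : 0 < c1 + d1) (hb1 : 0 < b1)
    (hab1 : a1 + b1 = c1 + d1) (hbd1 : b1 < d1) (ha0 : 0 < a0)
    (hglue : a0 * d1 = b1 * (c0 + d0)) (had0 : a0 < d0) (hcb1 : -b1 < c1)
    (hf : MonotoneOn f (Icc 0 1)) (hf0 : f 0 = 0) (hf1 : f 1 = 1)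
    (hdR0 : ∀ x ∈ Icc (0 : ℝ) (1 / 2), f x = Phi a0 0 c0 d0 (f (2 * x)))
    (hdR1 : ∀ x ∈ Icc (1 / 2 : ℝ) 1, f x = Phi a1 b1 c1 d1 (f (2 * x - 1)))
    (hfail : (c0 + d0 - 2 * a0) * (d0 - a0) ≠ a0 * c0 ∨
      (a1 - 2 * c1) * (d1 - 2 * b1) ≠ b1 * c1) :
    ∃ κ : ℝ, 1 ≤ κ ∧ κ < 2 ∧
      ∀ n, ∑ k ∈ Finset.range (4 ^ n), √(quadInc f n k) ≤ κ ^ n := by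
  have has0 : a0 < c0 + d0 := by nlinarith
  obtain ⟨L, hL1, hL⟩ : ∃ L : ℝ, -1 < L ∧ L < min 0 (min (c1 / b1) (c0 / (d0 - a0))) := by
    refine exists_between (lt_min (by norm_num) (lt_min ?_ ?_))
    · rw [lt_div_iff₀ hb1]
      linarith
    · rw [lt_div_iff₀ (by linarith)]
      linarith
  obtain ⟨hL0, hLH, hLG⟩ : L < 0 ∧ L * b1 < c1 ∧ L * (d0 - a0) < c0 := by
    rwa [lt_min_iff, lt_min_iff, lt_div_iff₀ hb1, lt_div_iff₀ (by linarith)] at hL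
  obtain ⟨U, hU⟩ : ∃ U : ℝ, max 0 (max (a1 / b1) (c0 / (d0 - a0))) ≤ U := ⟨_, le_rfl⟩
  obtain ⟨hU0, hUH, hUG⟩ : 0 ≤ U ∧ a1 ≤ U * b1 ∧ c0 ≤ U * (d0 - a0) := by
    rwa [max_le_iff, max_le_iff, div_le_iff₀ hb1, div_le_iff₀ (by linarith)] at hU
  let P : ℝ → ℝ := fun t => b1 * (1 + t) / (b1 * t + d1)
  let Q : ℝ → ℝ := fun t => (d1 - b1) / (b1 * t + d1)
  let G : ℝ → ℝ := fun t => (a0 * t + c0) / d0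
  let H : ℝ → ℝ := fun t => (a1 * t + c1) / (b1 * t + d1)
  have hgt : ∀ t ∈ Icc L U, -1 < t := fun t ht => hL1.trans_le ht.1
  have hden : ∀ t ∈ Icc L U, 0 < b1 * t + d1 := fun t ht => by nlinarith [hgt t ht]
  have hGK : MapsTo G (Icc L U) (Icc L U) := by
    intro t ht
    refine ⟨(le_div_iff₀ hd0).mpr ?_, (div_le_iff₀ hd0).mpr ?_⟩
    · nlinarith [ht.1]
    · nlinarith [ht.2]
  have hHK : MapsTo H (Icc L U) (Icc L U) := by
    intro t ht
    refine ⟨(le_div_iff₀ (hden t ht)).mpr ?_, (div_le_iff₀ (hden t ht)).mpr ?_⟩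
    · nlinarith [mul_nonneg (sub_nonneg.mpr ht.1) (by linarith : 0 ≤ a1 - L * b1),
        mul_nonneg (by linarith : 0 ≤ L + 1) (by linarith : 0 ≤ c1 - L * b1)]
    · nlinarith [mul_nonneg (by linarith [hgt t ht] : 0 ≤ t + 1) (sub_nonneg.mpr hUH),
        mul_nonneg (by linarith : 0 ≤ U + 1) (by linarith : 0 ≤ d1 - b1)]
  have hP0 : ∀ t ∈ Icc L U, 0 < P t := fun t ht =>
    div_pos (mul_pos hb1 (by linarith [hgt t ht])) (hden t ht)
  have hQ0 : ∀ t ∈ Icc L U, 0 < Q t := fun t ht => div_pos (by linarith) (hden t ht)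
  have hPQ : ∀ t ∈ Icc L U, P t + Q t = 1 := fun t ht => by
    rw [← add_div, div_eq_one_iff_eq (hden t ht).ne']
    ring
  have hhalf : ∀ t ∈ Icc L U, P t = 1 / 2 → b1 * t = d1 - 2 * b1 := fun t ht h => by
    rw [div_eq_div_iff (hden t ht).ne' two_ne_zero] at h
    linarith
  obtain ⟨κ, hκ1, hκ2, hκ⟩ := exists_sqrtTransfer_two_lt (P := P) (Q := Q) (G := G) (H := H)
    (K := Icc L U) isCompact_Icc (nonempty_Icc.mpr (by linarith))
    (ContinuousOn.div (by fun_prop) (by fun_prop) fun t ht => (hden t ht).ne')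
    (ContinuousOn.div (by fun_prop) (by fun_prop) fun t ht => (hden t ht).ne')
    (by fun_prop)
    (ContinuousOn.div (by fun_prop) (by fun_prop) fun t ht => (hden t ht).ne')
    hGK hHK hP0 hQ0 hPQ (by
      intro t ht h1 h2 h3
      have e1 := hhalf t ht h1
      have e2 : G t = t := mul_left_cancel₀ hb1.ne' ((hhalf _ (hGK ht) h2).trans e1.symm)
      have e3 : H t = t := mul_left_cancel₀ hb1.ne' ((hhalf _ (hHK ht) h3).trans e1.symm)
      rw [div_eq_iff hd0.ne'] at e2
      rw [div_eq_iff (hden t ht).ne'] at e3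
      have e4 : a0 * t = c0 + d0 - 2 * a0 :=
        mul_left_cancel₀ hb1.ne' (by linear_combination a0 * e1 + hglue)
      rcases hfail with h | h
      · exact h (by rw [← e4]; linear_combination -a0 * e2)
      · refine h ?_
        rw [e1] at e3
        rw [← e1]
        linear_combination -b1 * e3 + 2 * b1 * t * hab1)
  have hfI : ∀ x ∈ Icc (0 : ℝ) 1, f x ∈ Icc (0 : ℝ) 1 := fun x hx =>
    ⟨hf0 ▸ hf (left_mem_Icc.mpr zero_le_one) hx hx.1,
      hf1 ▸ hf hx (right_mem_Icc.mpr zero_le_one) hx.2⟩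
  have hrec : ∀ n, ∀ t ∈ Icc L U,
      sqrtLengthSum f (n + 1) t = sqrtTransfer P Q G H (sqrtLengthSum f n) t := by
    intro n t ht
    have hG : G t * d0 = a0 * t + c0 := div_mul_cancel₀ _ hd0.ne'
    have hH : H t * (b1 * t + d1) = a1 * t + c1 := div_mul_cancel₀ _ (hden t ht).ne'
    have hPe : P t * (b1 * t + d1) = b1 * (1 + t) := div_mul_cancel₀ _ (hden t ht).ne'
    have hQe : Q t * (b1 * t + d1) = d1 - b1 := div_mul_cancel₀ _ (hden t ht).ne'
    refine sqrtLengthSum_succ hfI hdR0 hdR1 (fun z => affine_pos_of_mem_Icc hd0 hs0)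
      (fun z => affine_pos_of_mem_Icc hd1 hs1) (by simpa using hd0)
      (hden t ht) (hgt _ (hGK ht)) (hgt _ (hHK ht)) (by rw [zero_mul, zero_add, hG]) hH
      (hP0 t ht).le (hQ0 t ht).le ?_ ?_ n
    · refine mul_left_cancel₀ hb1.ne' ?_
      linear_combination b1 * P t * d0 * hG + d0 * a0 * hPe - d0 * P t * hglue
    · linear_combination (1 + H t) * (b1 * t + d1) * hQe + (d1 - b1) * hH +
        (d1 - b1) * t * hab1 - (1 + t) * d1 * hab1
  refine ⟨κ, hκ1, hκ2, fun n => ?_⟩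
  rw [← sqrtLengthSum_two_mul_zero]
  exact iterate_sqrtTransfer_le (by linarith) hGK hHK hκ
    (fun t ht => sqrtLengthSum_zero hf0 hf1 (hgt t ht)) hrec n 0 ⟨hL0.le, hU0⟩

end Moebius

theorem stmt3
    (a0 b0 c0 d0 a1 b1 c1 d1 : ℝ)
    (hb0 : b0 = 0)
    (hA1a : 0 < (a0 + b0) / (c0 + d0))
    (hA1b : (a0 + b0) / (c0 + d0) = b1 / d1)
    (hA1c : b1 / d1 < (a1 + b1) / (c1 + d1))
    (hA1d : (a1 + b1) / (c1 + d1) = 1)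
    (hA20 : 0 < a0 * d0 - b0 * c0)
    (hA21 : 0 < a1 * d1 - b1 * c1)
    (hA30 : Real.sqrt (a0 * d0 - b0 * c0) < min d0 (c0 + d0))
    (hA31 : Real.sqrt (a1 * d1 - b1 * c1) < min d1 (c1 + d1))
    (f : ℝ → ℝ)
    (hfc : ContinuousOn f (Set.Icc 0 1))
    (hfm : StrictMonoOn f (Set.Icc 0 1))
    (hf0 : f 0 = 0) (hf1 : f 1 = 1)
    (hdR0 : ∀ x ∈ Set.Icc (0 : ℝ) (1 / 2), f x = Phi a0 b0 c0 d0 (f (2 * x)))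
    (hdR1 : ∀ x ∈ Set.Icc (1 / 2 : ℝ) 1, f x = Phi a1 b1 c1 d1 (f (2 * x - 1)))
    (μf : Measure ℝ) [IsProbabilityMeasure μf]
    (hμf : ∀ x ∈ Set.Icc (0 : ℝ) 1, μf (Set.Iic x) = ENNReal.ofReal (f x))
    (hfail : (c0 + d0 - 2 * a0) * (d0 - a0) ≠ a0 * c0 ∨ (a1 - 2 * c1) * (d1 - 2 * b1) ≠ b1 * c1) :
    (∃ K1 : Set ℝ, MeasurableSet K1 ∧ K1 ⊆ Set.Icc 0 1 ∧ μf K1 = 1 ∧ dimH K1 < 1) ∧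
    μf ⟂ₘ (volume : Measure ℝ) := by
  have hsq0 := Real.sqrt_nonneg (a0 * d0 - b0 * c0)
  have hsq1 := Real.sqrt_nonneg (a1 * d1 - b1 * c1)
  obtain ⟨hA30d, hA30s⟩ := lt_min_iff.mp hA30
  obtain ⟨hA31d, hA31s⟩ := lt_min_iff.mp hA31
  have hd0 : 0 < d0 := by linarith
  have hs0 : 0 < c0 + d0 := by linarith
  have hd1 : 0 < d1 := by linarith
  have hs1 : 0 < c1 + d1 := by linarith
  have hdet0 : a0 * d0 - b0 * c0 < d0 ^ 2 := (Real.sqrt_lt' hd0).mp hA30d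
  have hdet1 : a1 * d1 - b1 * c1 < (c1 + d1) ^ 2 := (Real.sqrt_lt' hs1).mp hA31s
  have hb1 : 0 < b1 := by
    rw [hA1b] at hA1a
    exact (div_pos_iff_of_pos_right hd1).mp hA1a
  have hab1 : a1 + b1 = c1 + d1 := (div_eq_one_iff_eq hs1.ne').mp hA1d
  have hbd1 : b1 < d1 := by
    rw [hA1d] at hA1c
    exact (div_lt_one hd1).mp hA1c
  have ha0 : 0 < a0 := by
    have := (div_pos_iff_of_pos_right hs0).mp hA1a
    linarith
  have hglue : a0 * d1 = b1 * (c0 + d0) := by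
    rw [div_eq_div_iff hs0.ne' hd1.ne', hb0, add_zero] at hA1b
    exact hA1b
  have had0 : a0 < d0 := by
    rw [hb0] at hdet0
    nlinarith
  have hcb1 : -b1 < c1 := by
    have e : a1 * d1 - b1 * c1 = (c1 + d1) * (d1 - b1) := by linear_combination d1 * hab1
    have : d1 - b1 < c1 + d1 := lt_of_mul_lt_mul_left (by nlinarith) hs1.le
    linarith
  subst hb0
  obtain ⟨κ, hκ1, hκ2, hsum⟩ := exists_sum_sqrt_quadInc_le hd0 hs0 hd1 hs1 hb1 hab1 hbd1 ha0
    hglue had0 hcb1 hfm.monotoneOn hf0 hf1 hdR0 hdR1 hfail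
  obtain ⟨K1, hK1m, hK1, hμK1, hdim⟩ :=
    exists_dimH_lt_one_of_sum_sqrt_le hfm.monotoneOn hf0 hf1 hμf hκ1 hκ2 hsum
  refine ⟨⟨K1, hK1m, hK1, hμK1, hdim⟩, K1ᶜ, hK1m.compl, ?_, ?_⟩
  · exact (prob_compl_eq_zero_iff hK1m).mpr hμK1
  · rw [compl_compl]
    exact volume_eq_zero_of_dimH_lt_one hdim
end

section
/- For every n ≥ 1 and x ∈ [0, 1): R_{n+1}(x)/R_n(x) = p_{X_{n+1}(x)}(r_n(x)/s_n(x)). -/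
open MeasureTheory Filter Set Matrix

/-- A continuous distribution function also gives the mass of open rays. -/
theorem measureReal_Iio_eq_of_continuousOn_cdf {f : ℝ → ℝ} {μ : Measure ℝ} [IsProbabilityMeasure μ]
    (hfc : ContinuousOn f (Set.Icc 0 1)) (hfm : StrictMonoOn f (Set.Icc 0 1)) (hf0 : f 0 = 0)
    (hμ : ∀ x ∈ Set.Icc (0 : ℝ) 1, μ (Set.Iic x) = ENNReal.ofReal (f x))
    {b : ℝ} (hb : b ∈ Set.Icc (0 : ℝ) 1) : μ.real (Set.Iio b) = f b := by
  have hIic : ∀ x ∈ Set.Icc (0 : ℝ) 1, μ.real (Set.Iic x) = f x := by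
    intro x hx
    rw [measureReal_def, hμ x hx, ENNReal.toReal_ofReal]
    rw [← hf0]
    exact hfm.monotoneOn ⟨le_rfl, zero_le_one⟩ hx hx.1
  have hle : μ.real (Set.Iio b) ≤ f b := by
    rw [← hIic b hb]
    exact measureReal_mono Set.Iio_subset_Iic_self
  refine le_antisymm hle ?_
  rcases hb.1.eq_or_lt with rfl | hb0
  · rw [hf0]
    exact measureReal_nonneg
  · have ht : Tendsto f (nhdsWithin b (Set.Ioo 0 b)) (nhds (f b)) :=
      (hfc b hb).mono_left
        (nhdsWithin_mono b fun y hy => ⟨hy.1.le, hy.2.le.trans hb.2⟩)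
    have : (nhdsWithin b (Set.Ioo 0 b)).NeBot := right_nhdsWithin_Ioo_neBot hb0
    refine le_of_tendsto ht ?_
    filter_upwards [self_mem_nhdsWithin] with y hy
    rw [← hIic y ⟨hy.1.le, hy.2.le.trans hb.2⟩]
    exact measureReal_mono fun z hz => lt_of_le_of_lt hz hy.2

theorem measureReal_Ico_eq_of_continuousOn_cdf {f : ℝ → ℝ} {μ : Measure ℝ} [IsProbabilityMeasure μ]
    (hfc : ContinuousOn f (Set.Icc 0 1)) (hfm : StrictMonoOn f (Set.Icc 0 1)) (hf0 : f 0 = 0)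
    (hμ : ∀ x ∈ Set.Icc (0 : ℝ) 1, μ (Set.Iic x) = ENNReal.ofReal (f x))
    {a b : ℝ} (ha : a ∈ Set.Icc (0 : ℝ) 1) (hb : b ∈ Set.Icc (0 : ℝ) 1) (hab : a ≤ b) :
    μ.real (Set.Ico a b) = f b - f a := by
  rw [← measureReal_Iio_eq_of_continuousOn_cdf hfc hfm hf0 hμ hb,
    ← measureReal_Iio_eq_of_continuousOn_cdf hfc hfm hf0 hμ ha,
    ← measureReal_sdiff (Set.Iio_subset_Iio hab) measurableSet_Iio]
  congr 1
  ext z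
  simp

theorem floor_two_pow_succ_mul (x : ℝ) (hx : 0 ≤ x) (n : ℕ) :
    (Xdig x (n + 1) = 0 ∨ Xdig x (n + 1) = 1) ∧
      ⌊(2 : ℝ) ^ (n + 1) * x⌋₊ = 2 * ⌊(2 : ℝ) ^ n * x⌋₊ + Xdig x (n + 1) := by
  have h0 : (0 : ℝ) ≤ 2 ^ n * x := by positivity
  have h1 := Nat.floor_le h0
  have h2 := Nat.lt_floor_add_one ((2 : ℝ) ^ n * x)
  have e : (2 : ℝ) ^ (n + 1) * x = 2 * (2 ^ n * x) := by ring
  have h3 : 2 * ⌊(2 : ℝ) ^ n * x⌋₊ ≤ ⌊(2 : ℝ) ^ (n + 1) * x⌋₊ := by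
    apply Nat.le_floor
    push_cast
    linarith
  have h4 : ⌊(2 : ℝ) ^ (n + 1) * x⌋₊ < 2 * ⌊(2 : ℝ) ^ n * x⌋₊ + 2 := by
    rw [Nat.floor_lt (by positivity)]
    push_cast
    linarith
  simp only [Xdig, Nat.add_sub_cancel]
  omega

theorem floor_two_pow_mul_lt {x : ℝ} (hx : x ∈ Set.Ico (0 : ℝ) 1) (n : ℕ) :
    (⌊(2 : ℝ) ^ n * x⌋₊ : ℝ) + 1 ≤ 2 ^ n := by
  have h : ⌊(2 : ℝ) ^ n * x⌋₊ < 2 ^ n := by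
    rw [Nat.floor_lt (mul_nonneg (by positivity) hx.1)]
    push_cast
    exact mul_lt_of_lt_one_right (by positivity) hx.2
  exact_mod_cast h

theorem add_mul_pos_of_mem_Icc {r s z : ℝ} (hs : 0 < s) (hrs : 0 < r + s)
    (hz : z ∈ Set.Icc (0 : ℝ) 1) : 0 < r * z + s := by
  nlinarith [mul_nonneg hz.1 hrs.le, mul_nonneg (sub_nonneg.2 hz.2) hs.le, hz.1, hz.2]

theorem matProd_succ (A : ℕ → Matrix (Fin 2) (Fin 2) ℝ) (x : ℝ) (n : ℕ) :
    matProd A x (n + 1) = matProd A x n * A (Xdig x (n + 1)) := by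
  simp [matProd, List.range_succ]

theorem PhiM_mul (M N : Matrix (Fin 2) (Fin 2) ℝ) (z : ℝ) (hN : N 1 0 * z + N 1 1 ≠ 0) :
    PhiM (M * N) z = PhiM M (PhiM N z) := by
  simp only [PhiM, Matrix.mul_apply, Fin.sum_univ_two]
  rw [← mul_div_mul_right _ (M 1 0 * _ + M 1 1) hN]
  congr 1 <;> field_simp <;> ring

/-- On each dyadic interval, a solution of de Rham's equation is a Möbius image of itself. -/
theorem apply_dyadic_eq_PhiM_matProd {f : ℝ → ℝ} {A : ℕ → Matrix (Fin 2) (Fin 2) ℝ}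
    (hmaps : ∀ t ∈ Set.Icc (0 : ℝ) 1, f t ∈ Set.Icc (0 : ℝ) 1)
    (hdet : ∀ e ∈ ({0, 1} : Set ℕ), 0 < (A e).det)
    (hs : ∀ e ∈ ({0, 1} : Set ℕ), 0 < A e 1 1)
    (hrs : ∀ e ∈ ({0, 1} : Set ℕ), 0 < A e 1 0 + A e 1 1)
    (hz0 : ∀ e ∈ ({0, 1} : Set ℕ), PhiM (A e) 0 ∈ Set.Icc (0 : ℝ) 1)
    (hz1 : ∀ e ∈ ({0, 1} : Set ℕ), PhiM (A e) 1 ∈ Set.Icc (0 : ℝ) 1)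
    (hf : ∀ e ∈ ({0, 1} : Set ℕ), ∀ t ∈ Set.Icc (0 : ℝ) 1, f ((e + t) / 2) = PhiM (A e) (f t))
    {x : ℝ} (hx : x ∈ Set.Ico (0 : ℝ) 1) (n : ℕ) :
    0 < (matProd A x n).det ∧ 0 < matProd A x n 1 1 ∧
      0 < matProd A x n 1 0 + matProd A x n 1 1 ∧
      ∀ t ∈ Set.Icc (0 : ℝ) 1,
        f ((⌊(2 : ℝ) ^ n * x⌋₊ + t) / 2 ^ n) = PhiM (matProd A x n) (f t) := by
  induction n with
  | zero => simp [matProd, PhiM, Nat.floor_eq_zero.2 hx.2]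
  | succ n ih =>
    obtain ⟨ihd, ihs, ihrs, ihf⟩ := ih
    obtain ⟨he, hfl⟩ := floor_two_pow_succ_mul x hx.1 n
    rw [matProd_succ, hfl]
    generalize Xdig x (n + 1) = e at he
    replace he : e ∈ ({0, 1} : Set ℕ) := he
    have hse := hs e he
    have hrse := hrs e he
    refine ⟨by rw [Matrix.det_mul]; exact mul_pos ihd (hdet e he), ?_, ?_, ?_⟩
    · have h := mul_pos hse (add_mul_pos_of_mem_Icc ihs ihrs (hz0 e he))
      simp only [PhiM, mul_zero, zero_add] at h
      simp only [Matrix.mul_apply, Fin.sum_univ_two]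
      refine h.trans_eq ?_
      field_simp
    · have h := mul_pos hrse (add_mul_pos_of_mem_Icc ihs ihrs (hz1 e he))
      simp only [PhiM, mul_one] at h
      simp only [Matrix.mul_apply, Fin.sum_univ_two]
      refine h.trans_eq ?_
      field_simp
      ring
    · intro t ht
      rw [PhiM_mul _ _ _ (add_mul_pos_of_mem_Icc hse hrse (hmaps t ht)).ne', ← hf e he t ht,
        ← ihf]
      · congr 1
        push_cast
        field_simp
        ring
      · have : (e : ℝ) ∈ Set.Icc (0 : ℝ) 1 := by
          rcases he with rfl | rfl <;> simp
        exact ⟨by linarith [this.1, ht.1], by linarith [this.2, ht.2]⟩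

theorem stmt5
    (a0 b0 c0 d0 a1 b1 c1 d1 : ℝ)
    (hb0 : b0 = 0)
    (hA1a : 0 < (a0 + b0) / (c0 + d0))
    (hA1b : (a0 + b0) / (c0 + d0) = b1 / d1)
    (hA1c : b1 / d1 < (a1 + b1) / (c1 + d1))
    (hA1d : (a1 + b1) / (c1 + d1) = 1)
    (hA20 : 0 < a0 * d0 - b0 * c0)
    (hA21 : 0 < a1 * d1 - b1 * c1)
    (hA30 : Real.sqrt (a0 * d0 - b0 * c0) < min d0 (c0 + d0))
    (hA31 : Real.sqrt (a1 * d1 - b1 * c1) < min d1 (c1 + d1))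
    (f : ℝ → ℝ)
    (hfc : ContinuousOn f (Set.Icc 0 1))
    (hfm : StrictMonoOn f (Set.Icc 0 1))
    (hf0 : f 0 = 0) (hf1 : f 1 = 1)
    (hdR0 : ∀ x ∈ Set.Icc (0 : ℝ) (1 / 2), f x = Phi a0 b0 c0 d0 (f (2 * x)))
    (hdR1 : ∀ x ∈ Set.Icc (1 / 2 : ℝ) 1, f x = Phi a1 b1 c1 d1 (f (2 * x - 1)))
    (μf : Measure ℝ) [IsProbabilityMeasure μf]
    (hμf : ∀ x ∈ Set.Icc (0 : ℝ) 1, μf (Set.Iic x) = ENNReal.ofReal (f x))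
    (γ : ℝ) (hγ : γ = 1 / Phi a0 b0 c0 d0 1)
    (A : ℕ → Matrix (Fin 2) (Fin 2) ℝ)
    (hAm0 : A 0 = !![a0, b0; c0, d0])
    (hAm1 : A 1 = !![a1, b1; c1, d1])
    :
    ∀ n : ℕ, 1 ≤ n → ∀ x ∈ Set.Ico (0 : ℝ) 1,
      (μf (dyadI x (n + 1))).toReal / (μf (dyadI x n)).toReal =
        (if Xdig x (n + 1) = 0
         then (matProd A x n 1 0 / matProd A x n 1 1 + 1) / (matProd A x n 1 0 / matProd A x n 1 1 + γ)
         else 1 - (matProd A x n 1 0 / matProd A x n 1 1 + 1) / (matProd A x n 1 0 / matProd A x n 1 1 + γ)) := by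
  subst hb0
  have hd0 : 0 < d0 := (Real.sqrt_nonneg _).trans_lt (hA30.trans_le (min_le_left _ _))
  have hcd0 : 0 < c0 + d0 := (Real.sqrt_nonneg _).trans_lt (hA30.trans_le (min_le_right _ _))
  have hd1 : 0 < d1 := (Real.sqrt_nonneg _).trans_lt (hA31.trans_le (min_le_left _ _))
  have hcd1 : 0 < c1 + d1 := (Real.sqrt_nonneg _).trans_lt (hA31.trans_le (min_le_right _ _))
  have hmaps : ∀ t ∈ Set.Icc (0 : ℝ) 1, f t ∈ Set.Icc (0 : ℝ) 1 := fun t ht =>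
    ⟨hf0 ▸ hfm.monotoneOn ⟨le_rfl, zero_le_one⟩ ht ht.1,
      hf1 ▸ hfm.monotoneOn ht ⟨zero_le_one, le_rfl⟩ ht.2⟩
  intro n _ x hx
  obtain ⟨hdet, hs, hrs, hf⟩ := apply_dyadic_eq_PhiM_matProd (f := f) (A := A) hmaps
    (by rintro e (rfl | rfl) <;> simp [hAm0, hAm1, Matrix.det_fin_two] <;> linarith)
    (by rintro e (rfl | rfl) <;> simpa [hAm0, hAm1])
    (by rintro e (rfl | rfl) <;> simpa [hAm0, hAm1])
    (by
      rintro e (rfl | rfl)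
      · simp [hAm0, PhiM]
      · simp only [hAm1, PhiM]
        simpa using ⟨(hA1b ▸ hA1a).le, (hA1c.trans_eq hA1d).le⟩)
    (by
      rintro e (rfl | rfl)
      · simp only [hAm0, PhiM]
        simpa using ⟨by simpa using hA1a.le, by simpa using (hA1b.trans_lt (hA1c.trans_eq hA1d)).le⟩
      · simp only [hAm1, PhiM]
        simp [hA1d])
    (by
      rintro e (rfl | rfl) t ht
      · rw [hdR0 _ ⟨by linarith [ht.1, Nat.cast_zero (R := ℝ)],
          by linarith [ht.2, Nat.cast_zero (R := ℝ)]⟩]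
        simp only [hAm0, PhiM, Phi]
        simp [mul_div_cancel₀]
      · rw [hdR1 _ ⟨by linarith [ht.1, Nat.cast_one (R := ℝ)],
          by linarith [ht.2, Nat.cast_one (R := ℝ)]⟩]
        simp only [hAm1, PhiM, Phi]
        simp [mul_div_cancel₀])
    hx n
  obtain ⟨y, hy⟩ : ∃ y, f (1 / 2) = y := ⟨_, rfl⟩
  have hhalf : (1 / 2 : ℝ) ∈ Set.Icc (0 : ℝ) 1 := by norm_num
  have hγy : γ = 1 / y := by
    rw [hγ, ← hy, hdR0 (1 / 2) (by norm_num)]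
    norm_num [hf1]
  have hy0 : 0 < y := by
    rw [← hy, ← hf0]
    exact hfm ⟨le_rfl, zero_le_one⟩ hhalf one_half_pos
  have hy1 : y < 1 := by
    rw [← hy]
    exact (hfm hhalf ⟨zero_le_one, le_rfl⟩ one_half_lt_one).trans_eq hf1
  have hpow : (0 : ℝ) < 2 ^ n := by positivity
  have hmem : ∀ t ∈ Set.Icc (0 : ℝ) 1,
      ((⌊(2 : ℝ) ^ n * x⌋₊ : ℝ) + t) / 2 ^ n ∈ Set.Icc (0 : ℝ) 1 := fun t ht =>
    ⟨div_nonneg (add_nonneg (Nat.cast_nonneg _) ht.1) hpow.le,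
      (div_le_one hpow).2 (by linarith [ht.2, floor_two_pow_mul_lt hx n])⟩
  have hmass : ∀ u ∈ Set.Icc (0 : ℝ) 1, ∀ v ∈ Set.Icc (0 : ℝ) 1, u ≤ v →
      (μf (Set.Ico (((⌊(2 : ℝ) ^ n * x⌋₊ : ℝ) + u) / 2 ^ n)
        (((⌊(2 : ℝ) ^ n * x⌋₊ : ℝ) + v) / 2 ^ n))).toReal =
      PhiM (matProd A x n) (f v) - PhiM (matProd A x n) (f u) := by
    intro u hu v hv huv
    rw [← measureReal_def, measureReal_Ico_eq_of_continuousOn_cdf hfc hfm hf0 hμf (hmem u hu)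
      (hmem v hv) (by gcongr), hf u hu, hf v hv]
  have h0 : (0 : ℝ) ∈ Set.Icc (0 : ℝ) 1 := by norm_num
  have h1 : (1 : ℝ) ∈ Set.Icc (0 : ℝ) 1 := by norm_num
  have hR : (μf (dyadI x n)).toReal =
      PhiM (matProd A x n) 1 - PhiM (matProd A x n) 0 := by
    have h := hmass 0 h0 1 h1 zero_le_one
    rwa [hf0, hf1, add_zero] at h
  have hrys := add_mul_pos_of_mem_Icc hs hrs ⟨hy0.le, hy1.le⟩
  have hsplit : (μf (dyadI x (n + 1))).toReal = if Xdig x (n + 1) = 0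
      then PhiM (matProd A x n) y - PhiM (matProd A x n) 0
      else PhiM (matProd A x n) 1 - PhiM (matProd A x n) y := by
    obtain ⟨he, hfl⟩ := floor_two_pow_succ_mul x hx.1 n
    rw [dyadI, hfl]
    rcases he with he | he <;> rw [he]
    · have h := hmass 0 h0 (1 / 2) hhalf one_half_pos.le
      rw [hf0, hy] at h
      rw [if_pos rfl, ← h]
      congr 3 <;> push_cast <;> field_simp <;> ring
    · have h := hmass (1 / 2) hhalf 1 h1 one_half_lt_one.le
      rw [hf1, hy] at h
      rw [if_neg one_ne_zero, ← h]
      congr 3 <;> push_cast <;> field_simp <;> ring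
  rw [hsplit, hR, hγy]
  rw [Matrix.det_fin_two] at hdet
  simp only [PhiM, mul_one, mul_zero, zero_add]
  generalize matProd A x n 0 0 = p at *
  generalize matProd A x n 0 1 = q at *
  generalize matProd A x n 1 0 = r at *
  generalize matProd A x n 1 1 = s at *
  have hden : (p + q) / (r + s) - q / s = (p * s - q * r) / ((r + s) * s) := by
    field_simp
    ring
  have hleft : (p * y + q) / (r * y + s) - q / s = (p * s - q * r) * y / ((r * y + s) * s) := by
    rw [div_sub_div _ _ hrys.ne' hs.ne']
    ring
  have hden0 : (p + q) / (r + s) - q / s ≠ 0 := by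
    rw [hden]
    positivity
  have hratio : ((p * y + q) / (r * y + s) - q / s) / ((p + q) / (r + s) - q / s) =
      (r / s + 1) / (r / s + 1 / y) := by
    have hD : p * s - q * r ≠ 0 := hdet.ne'
    have e : r / s + 1 / y = (r * y + s) / (s * y) := by field_simp
    rw [hden, hleft, e]
    field_simp
  split_ifs
  · exact hratio
  · rw [← hratio, eq_sub_iff_add_eq, ← add_div, sub_add_sub_cancel, div_self hden0]
end
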